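/- arXiv:2409.01260 — 7 statements merged into one kernel-verified Lean document; each statement's English description precedes it below -/
import Mathlib

section
/- Let Ω ⊆ ℝⁿ be a domain and let f ∈ W^{1,1}_loc(Ω,ℝⁿ) be a mapping with Jacobian J_f > 0 almost everywhere which is NOT injective almost everywhere (i.e. there is no set N of Lebesgue measure zero such that f restricted to Ω \ N is injective). Then there exist two Lebesgue measurable sets A, B ⊆ Ω with |A| > 0, |B| > 0, A ∩ B = ∅ and f(A) = f(B). Moreover A and B can be chosen so that, in addition: for every measurable E ⊆ A with |E| > 0 there exists a measurable F ⊆ B with |F| > 0 and f(E) = f(F), and for every measurable E ⊆ B with |E| > 0 there exists a measurable F ⊆ A with |F| > 0 and f(E) = f(F). -/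
open MeasureTheory Filter Metric Set
open scoped ENNReal Topology

/-- `Df` is the matrix of weak (distributional) partial derivatives of `f` on the open set
`Ω ⊆ ℝⁿ`: for every smooth compactly supported test function `φ` with support contained in `Ω`
and all indices `i j` we have `∫_Ω fᵢ ∂ⱼφ = - ∫_Ω (Df)ᵢⱼ φ`. -/
def IsWeakDerivOn (n : ℕ) (Ω : Set (EuclideanSpace ℝ (Fin n)))
    (f : EuclideanSpace ℝ (Fin n) → EuclideanSpace ℝ (Fin n))
    (Df : EuclideanSpace ℝ (Fin n) → Matrix (Fin n) (Fin n) ℝ) : Prop :=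
  ∀ φ : EuclideanSpace ℝ (Fin n) → ℝ, ContDiff ℝ (⊤ : ℕ∞) φ → HasCompactSupport φ →
    tsupport φ ⊆ Ω → ∀ i j : Fin n,
      ∫ x in Ω, f x i * fderiv ℝ φ x (EuclideanSpace.single j 1)
        = - ∫ x in Ω, Df x i j * φ x

/-- `f ∈ W^{1,1}_loc(Ω, ℝⁿ)` with weak differential `Df`: both `f` and `Df` are locally
integrable on `Ω` and `Df` is the weak derivative of `f` on `Ω`. -/
def MemW11loc (n : ℕ) (Ω : Set (EuclideanSpace ℝ (Fin n)))
    (f : EuclideanSpace ℝ (Fin n) → EuclideanSpace ℝ (Fin n))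
    (Df : EuclideanSpace ℝ (Fin n) → Matrix (Fin n) (Fin n) ℝ) : Prop :=
  LocallyIntegrableOn f Ω volume ∧
  (∀ i j : Fin n, LocallyIntegrableOn (fun x => Df x i j) Ω volume) ∧
  IsWeakDerivOn n Ω f Df


lemma aux_hasDeriv {n : ℕ} (η : EuclideanSpace ℝ (Fin n) → ℝ) (hη : ContDiff ℝ (⊤ : ℕ∞) η)
    (x z : EuclideanSpace ℝ (Fin n)) (t : ℝ) (ht : 0 < t) :
    HasDerivAt (fun t : ℝ => (t⁻¹) ^ n * η (x + t⁻¹ • (z - x)))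
      (-((t⁻¹) ^ (n+1) * (n * η (x + t⁻¹ • (z - x)) +
        fderiv ℝ η (x + t⁻¹ • (z - x)) (t⁻¹ • (z - x))))) t := by
  have h1 : HasDerivAt (fun t : ℝ => t⁻¹) (-(t^2)⁻¹) t := hasDerivAt_inv ht.ne'
  have h2 : HasDerivAt (fun t : ℝ => x + t⁻¹ • (z - x)) ((-(t^2)⁻¹) • (z - x)) t :=
    (h1.smul_const (z - x)).const_add x
  have h3 : HasFDerivAt η (fderiv ℝ η (x + t⁻¹ • (z - x))) (x + t⁻¹ • (z - x)) :=
    (hη.differentiable (by simp) _).hasFDerivAt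
  have h4 := h3.comp_hasDerivAt t h2
  have h5 := (h1.fun_pow n).mul h4
  refine h5.congr_deriv ?_
  simp only [map_smul, smul_eq_mul, Function.comp]
  rcases n with _ | m
  · simp; field_simp
  · simp only [Nat.add_sub_cancel, ← inv_pow]
    ring

lemma aux_fderiv {n : ℕ} (η : EuclideanSpace ℝ (Fin n) → ℝ) (hη : ContDiff ℝ (⊤ : ℕ∞) η)
    (x z : EuclideanSpace ℝ (Fin n)) (t : ℝ) (j : Fin n) :
    fderiv ℝ (fun z : EuclideanSpace ℝ (Fin n) =>
        (t⁻¹) ^ (n+1) * ((z j - x j) * η (x + t⁻¹ • (z - x)))) z (EuclideanSpace.single j 1)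
     = (t⁻¹) ^ (n+1) * (η (x + t⁻¹ • (z - x)) +
        (z j - x j) * (t⁻¹ * fderiv ℝ η (x + t⁻¹ • (z - x)) (EuclideanSpace.single j 1))) := by
  have h1 : HasFDerivAt (fun z : EuclideanSpace ℝ (Fin n) => z j - x j)
      (EuclideanSpace.proj j : EuclideanSpace ℝ (Fin n) →L[ℝ] ℝ) z :=
    (EuclideanSpace.proj j : EuclideanSpace ℝ (Fin n) →L[ℝ] ℝ).hasFDerivAt.sub_const _
  have h2 : HasFDerivAt (fun z : EuclideanSpace ℝ (Fin n) => x + t⁻¹ • (z - x))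
      (t⁻¹ • ContinuousLinearMap.id ℝ _) z :=
    (((hasFDerivAt_id z).sub_const x).const_smul t⁻¹).const_add x
  have h3 : HasFDerivAt η (fderiv ℝ η (x + t⁻¹ • (z - x))) (x + t⁻¹ • (z - x)) :=
    (hη.differentiable (by simp) _).hasFDerivAt
  have h4 := (h1.mul (h3.comp z h2)).const_mul ((t⁻¹)^(n+1))
  have h5 := h4.fderiv
  simp only [Function.comp_apply] at h5
  erw [h5]
  simp
  ring

lemma aux_sum {n : ℕ} (T : EuclideanSpace ℝ (Fin n) →L[ℝ] ℝ) (v : EuclideanSpace ℝ (Fin n)) :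
    ∑ j, v j * T (EuclideanSpace.single j 1) = T v := by
  conv_rhs => rw [← (EuclideanSpace.basisFun (Fin n) ℝ).sum_repr v]
  simp

lemma core {n : ℕ} (u : EuclideanSpace ℝ (Fin n) → ℝ) (w : Fin n → EuclideanSpace ℝ (Fin n) → ℝ)
    (hu : LocallyIntegrable u) (hw : ∀ j, LocallyIntegrable (w j))
    (V : Set (EuclideanSpace ℝ (Fin n)))
    (hweak : ∀ φ : EuclideanSpace ℝ (Fin n) → ℝ, ContDiff ℝ (⊤ : ℕ∞) φ → HasCompactSupport φ →
      tsupport φ ⊆ V → ∀ j : Fin n,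
      ∫ z, u z * fderiv ℝ φ z (EuclideanSpace.single j 1) = - ∫ z, w j z * φ z)
    (x : EuclideanSpace ℝ (Fin n)) (R : ℝ) (hR : 0 < R) (hV : closedBall x R ⊆ V)
    (hLeb : ∀ δ > 0, ∃ s₀ > 0, ∀ s, 0 < s → s ≤ s₀ →
      ∫ z in closedBall x s, |u z - u x| ≤ δ * s ^ n)
    (ε : ℝ) (hε : ∀ s, 0 < s → s ≤ R → ∫ z in ball x s, ∑ j, |w j z| ≤ ε * s ^ n)
    (η : EuclideanSpace ℝ (Fin n) → ℝ) (hη : ContDiff ℝ (⊤ : ℕ∞) η)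
    (M : ℝ) (hη0 : ∀ z, 0 ≤ η z) (hηM : ∀ z, η z ≤ M) (hηs : ∀ z, z ∉ ball x R → η z = 0)
    (hη1 : ∫ z, η z = 1) :
    |(∫ z, u z * η z) - u x| ≤ M * R * ε * R ^ n := by
  have hM : 0 ≤ M := (hη0 x).trans (hηM x)
  set q : EuclideanSpace ℝ (Fin n) → ℝ := fun y => n * η y + fderiv ℝ η y (y - x) with hq
  have hηts : tsupport η ⊆ closedBall x R := by
    apply closure_minimal _ isClosed_closedBall
    intro z hz
    by_contra h
    exact hz (hηs z (fun h' => h (ball_subset_closedBall h')))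
  have hηc : HasCompactSupport η := HasCompactSupport.of_support_subset_isCompact
    (isCompact_closedBall x R) ((subset_tsupport _).trans hηts)
  have hqcont : Continuous q := by
    have := hη.continuous
    have h2 : Continuous (fderiv ℝ η) := hη.continuous_fderiv (by simp)
    fun_prop
  have hq0 : ∀ y, y ∉ closedBall x R → q y = 0 := by
    intro y hy
    have h1 : y ∉ tsupport η := fun h => hy (hηts h)
    have h2 : fderiv ℝ η y = 0 := by
      by_contra h
      exact h1 (support_fderiv_subset ℝ h)
    simp [hq, h2, image_eq_zero_of_notMem_tsupport h1]
  have hqc : HasCompactSupport q := HasCompactSupport.intro (isCompact_closedBall x R) hq0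
  obtain ⟨C0, hC0⟩ := hqc.exists_bound_of_continuous hqcont
  have hmem : ∀ t : ℝ, 0 < t → ∀ z, x + t⁻¹ • (z - x) ∈ closedBall x R → z ∈ closedBall x (t * R) := by
    intro t ht z hz
    simp only [mem_closedBall, dist_eq_norm, add_sub_cancel_left, norm_smul, norm_inv, Real.norm_eq_abs, abs_of_pos ht] at hz ⊢
    rwa [inv_mul_le_iff₀ ht] at hz
  have hmem' : ∀ t : ℝ, 0 < t → ∀ z, x + t⁻¹ • (z - x) ∈ ball x R → z ∈ ball x (t * R) := by
    intro t ht z hz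
    simp only [mem_ball, dist_eq_norm, add_sub_cancel_left, norm_smul, norm_inv, Real.norm_eq_abs, abs_of_pos ht] at hz ⊢
    rwa [inv_mul_lt_iff₀ ht] at hz
  -- the regularised values
  set U : ℝ → ℝ := fun t => ∫ z, u z * ((t⁻¹) ^ n * η (x + t⁻¹ • (z - x))) with hU
  have hcs : ∀ t : ℝ, 0 < t → HasCompactSupport (fun z => η (x + t⁻¹ • (z - x))) := by
    intro t ht
    refine HasCompactSupport.intro (isCompact_closedBall x (t * R)) fun z hz => hηs _ fun h => hz (hmem t ht z (ball_subset_closedBall h))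
  have hint : ∀ g : EuclideanSpace ℝ (Fin n) → ℝ, Continuous g → HasCompactSupport g →
      ∀ v : EuclideanSpace ℝ (Fin n) → ℝ, LocallyIntegrable v → Integrable (fun z => v z * g z) := by
    intro g hg hgc v hv
    have := hv.integrable_smul_left_of_hasCompactSupport hg hgc
    simpa [mul_comm] using this
  have hUderiv : ∀ t : ℝ, 0 < t → HasDerivAt U
      (∫ z, u z * (-((t⁻¹) ^ (n+1) * q (x + t⁻¹ • (z - x))))) t := by
    intro t₀ ht₀
    refine (hasDerivAt_integral_of_dominated_loc_of_deriv_le (μ := volume)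
      (F := fun t z => u z * ((t⁻¹) ^ n * η (x + t⁻¹ • (z - x))))
      (F' := fun t z => u z * (-((t⁻¹) ^ (n+1) * q (x + t⁻¹ • (z - x)))))
      (bound := (closedBall x (2 * t₀ * R)).indicator (fun z => |u z| * (((t₀/2)⁻¹) ^ (n+1) * C0)))
      (s := Ioo (t₀/2) (2*t₀)) (Ioo_mem_nhds (by linarith) (by linarith)) ?_ ?_ ?_ ?_ ?_ ?_).2
    · refine Eventually.of_forall fun t => ?_
      refine hu.aestronglyMeasurable.mul (Continuous.aestronglyMeasurable ?_)
      have := hη.continuous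
      fun_prop
    · refine hint _ (by have := hη.continuous; fun_prop) ((hcs t₀ ht₀).mul_left) u hu
    · refine hu.aestronglyMeasurable.mul (Continuous.aestronglyMeasurable ?_)
      fun_prop
    · refine Eventually.of_forall fun z t ht => ?_
      have ht0 : 0 < t := by linarith [ht.1]
      by_cases hz : z ∈ closedBall x (2 * t₀ * R)
      · rw [indicator_of_mem hz, norm_mul, norm_neg, norm_mul, norm_pow, norm_inv, Real.norm_eq_abs, Real.norm_eq_abs t, abs_of_pos ht0]
        gcongr
        · exact ht.1.le
        · exact hC0 _
      · rw [indicator_of_notMem hz, hq0]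
        · simp
        · intro h
          apply hz
          refine closedBall_subset_closedBall ?_ (hmem t ht0 z h)
          have := ht.2.le
          gcongr
    · rw [integrable_indicator_iff measurableSet_closedBall]
      exact ((hu.integrableOn_isCompact (isCompact_closedBall _ _)).abs.mul_const _)
    · refine Eventually.of_forall fun z t ht => ?_
      have ht0 : 0 < t := by linarith [ht.1]
      have := (aux_hasDeriv η hη x z t ht0).const_mul (u z)
      simpa [hq] using this
  have hU' : ∀ t : ℝ, 0 < t → t ≤ 1 →
      |∫ z, u z * (-((t⁻¹) ^ (n+1) * q (x + t⁻¹ • (z - x))))| ≤ M * R * ε * R ^ n := by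
    intro t ht ht1
    set φ : Fin n → EuclideanSpace ℝ (Fin n) → ℝ := fun j z =>
        (t⁻¹) ^ (n+1) * ((z j - x j) * η (x + t⁻¹ • (z - x))) with hφ
    have hφd : ∀ j, ContDiff ℝ (⊤ : ℕ∞) (φ j) := by
      intro j
      refine contDiff_const.mul (ContDiff.mul ?_ (hη.comp ?_))
      · exact (EuclideanSpace.proj j : EuclideanSpace ℝ (Fin n) →L[ℝ] ℝ).contDiff.sub contDiff_const
      · fun_prop
    have hφ0 : ∀ j z, z ∉ ball x (t * R) → φ j z = 0 := by
      intro j z hz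
      simp only [hφ]
      rw [hηs _ (fun h => hz (hmem' t ht z h))]; simp
    have hφs : ∀ j, tsupport (φ j) ⊆ closedBall x (t * R) := by
      intro j
      apply closure_minimal _ isClosed_closedBall
      intro z hz
      by_contra h
      exact hz (hφ0 j z (fun h' => h (ball_subset_closedBall h')))
    have hφc : ∀ j, HasCompactSupport (φ j) := fun j =>
      HasCompactSupport.of_support_subset_isCompact (isCompact_closedBall x (t * R))
        ((subset_tsupport _).trans (hφs j))
    have hball : closedBall x (t * R) ⊆ V := (closedBall_subset_closedBall (by nlinarith)).trans hV
    have hw' := fun j => hweak (φ j) (hφd j) (hφc j) ((hφs j).trans hball) j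
    have hsum : ∀ z, t⁻¹ ^ (n+1) * q (x + t⁻¹ • (z - x)) =
        ∑ j, fderiv ℝ (φ j) z (EuclideanSpace.single j 1) := by
      intro z
      simp only [hφ]
      simp_rw [aux_fderiv η hη x z t, ← Finset.mul_sum, Finset.sum_add_distrib]
      congr 1
      simp only [hq, Finset.sum_const, Finset.card_univ, Fintype.card_fin, nsmul_eq_mul, add_sub_cancel_left]
      congr 1
      rw [← aux_sum]
      refine Finset.sum_congr rfl fun j _ => ?_
      simp; ring
    have hintφ : ∀ j, Integrable (fun z => u z * fderiv ℝ (φ j) z (EuclideanSpace.single j 1)) := by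
      intro j
      refine hint _ ?_ ((hφc j).fderiv_apply ℝ _) u hu
      exact ((hφd j).continuous_fderiv (by simp)).clm_apply continuous_const
    have hintw : ∀ j, Integrable (fun z => w j z * φ j z) := fun j =>
      hint _ (hφd j).continuous (hφc j) _ (hw j)
    have e1 : ∫ z, u z * (-((t⁻¹) ^ (n+1) * q (x + t⁻¹ • (z - x)))) = ∫ z, ∑ j, w j z * φ j z := by
      rw [integral_finsetSum _ (fun j _ => hintw j)]
      simp_rw [hsum, mul_neg, integral_neg, Finset.mul_sum]
      rw [integral_finsetSum _ (fun j _ => hintφ j), ← Finset.sum_neg_distrib]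
      refine Finset.sum_congr rfl fun j _ => ?_
      rw [hw' j, neg_neg]
    rw [e1, ← setIntegral_eq_integral_of_forall_compl_eq_zero (s := ball x (t * R))
      (fun z hz => Finset.sum_eq_zero fun j _ => by rw [hφ0 j z hz, mul_zero])]
    have hwint : IntegrableOn (fun z => ∑ j, |w j z|) (ball x (t * R)) := by
      refine integrable_finsetSum _ fun j _ => ?_
      exact (((hw j).integrableOn_isCompact (isCompact_closedBall x (t*R))).mono_set ball_subset_closedBall).abs
    calc |∫ z in ball x (t * R), ∑ j, w j z * φ j z|
        ≤ ∫ z in ball x (t * R), (∑ j, |w j z|) * (t⁻¹ ^ (n+1) * ((t * R) * M)) := by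
          rw [← Real.norm_eq_abs]
          refine norm_integral_le_of_norm_le (hwint.mul_const _) ?_
          filter_upwards [ae_restrict_mem measurableSet_ball] with z hz
          refine (norm_sum_le _ _).trans ?_
          rw [Finset.sum_mul]
          refine Finset.sum_le_sum fun j _ => ?_
          rw [norm_mul, Real.norm_eq_abs]
          gcongr
          simp only [hφ, norm_mul, norm_pow, norm_inv, Real.norm_eq_abs, abs_of_pos ht]
          gcongr
          · rw [mem_ball, dist_eq_norm] at hz
            have := PiLp.norm_apply_le (z - x) j
            simp at this
            exact this.trans hz.le
          · rw [abs_of_nonneg (hη0 _)]; exact hηM _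
      _ = (∫ z in ball x (t * R), (∑ j, |w j z|)) * (t⁻¹ ^ (n+1) * ((t * R) * M)) := by
          rw [integral_mul_const]
      _ ≤ (ε * (t * R) ^ n) * (t⁻¹ ^ (n+1) * ((t * R) * M)) := by
          gcongr
          exact hε _ (by positivity) (by nlinarith)
      _ = M * R * ε * R ^ n := by
          simp only [mul_pow, inv_pow, pow_succ]
          field_simp
  have hUd : ∀ s : ℝ, 0 < s → s ≤ 1 → |U 1 - U s| ≤ M * R * ε * R ^ n := by
    intro s hs hs1
    have := (convex_Icc s 1).norm_image_sub_le_of_norm_hasDerivWithin_le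
      (f := U) (C := M * R * ε * R ^ n)
      (fun t ht => (hUderiv t (hs.trans_le ht.1)).hasDerivWithinAt)
      (fun t ht => hU' t (hs.trans_le ht.1) ht.2) (left_mem_Icc.2 hs1) (right_mem_Icc.2 hs1)
    refine this.trans ?_
    have h0 : 0 ≤ M * R * ε * R ^ n := (abs_nonneg _).trans (hU' 1 one_pos le_rfl)
    rw [Real.norm_eq_abs, abs_of_nonneg (by linarith)]
    nlinarith
  have hU1 : U 1 = ∫ z, u z * η z := by simp [hU]
  have hmass : ∀ s : ℝ, 0 < s → ∫ z, s⁻¹ ^ n * η (x + s⁻¹ • (z - x)) = 1 := by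
    intro s hs
    rw [integral_const_mul, integral_sub_right_eq_self (fun z => η (x + s⁻¹ • z)) x,
      Measure.integral_comp_smul volume (fun z => η (x + z)), integral_add_left_eq_self, hη1]
    simp only [finrank_euclideanSpace, Fintype.card_fin, smul_eq_mul, mul_one]
    rw [abs_of_pos (by positivity)]
    field_simp
  have hUlim : ∀ δ > 0, ∃ s₀ > 0, ∀ s, 0 < s → s ≤ s₀ → |U s - u x| ≤ δ * (R ^ n * M) := by
    intro δ hδ
    obtain ⟨s₀, hs₀, h⟩ := hLeb δ hδ
    refine ⟨s₀ / R, by positivity, fun s hs hss => ?_⟩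
    have hc : Continuous (fun z => s⁻¹ ^ n * η (x + s⁻¹ • (z - x))) := by
      have := hη.continuous
      fun_prop
    have e : U s - u x = ∫ z, (u z - u x) * (s⁻¹ ^ n * η (x + s⁻¹ • (z - x))) := by
      simp_rw [sub_mul]
      rw [integral_sub, integral_const_mul, hmass s hs, mul_one]
      · exact hint _ hc ((hcs s hs).mul_left) u hu
      · exact (hc.integrable_of_hasCompactSupport ((hcs s hs).mul_left)).const_mul _
    rw [e, ← setIntegral_eq_integral_of_forall_compl_eq_zero (s := closedBall x (s * R))
      (fun z hz => by rw [hηs _ (fun h => hz (hmem s hs z (ball_subset_closedBall h)))]; simp)]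
    have hi : IntegrableOn (fun z => |u z - u x|) (closedBall x (s * R)) := by
      refine ((hu.integrableOn_isCompact (isCompact_closedBall _ _)).sub ?_).abs
      exact integrableOn_const (by exact (measure_closedBall_lt_top).ne)
    calc _ ≤ ∫ z in closedBall x (s * R), |u z - u x| * (s⁻¹ ^ n * M) := by
          rw [← Real.norm_eq_abs]
          refine norm_integral_le_of_norm_le (hi.mul_const _) (Eventually.of_forall fun z => ?_)
          rw [norm_mul, norm_mul, Real.norm_eq_abs, Real.norm_eq_abs, Real.norm_eq_abs, abs_of_nonneg (hη0 _), abs_of_nonneg (by positivity : 0 ≤ s⁻¹ ^ n)]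
          gcongr
          exact hηM _
      _ = (∫ z in closedBall x (s * R), |u z - u x|) * (s⁻¹ ^ n * M) := by
          rw [integral_mul_const]
      _ ≤ (δ * (s * R) ^ n) * (s⁻¹ ^ n * M) := by
          gcongr
          refine h _ (by positivity) ?_
          rwa [le_div_iff₀ hR] at hss
      _ = _ := by
          simp only [mul_pow, inv_pow]
          field_simp
  rw [← hU1]
  refine le_of_forall_pos_le_add fun κ hκ => ?_
  obtain ⟨s₀, hs₀, h⟩ := hUlim (κ / (R ^ n * M + 1)) (by positivity)
  have h1 := hUd (min s₀ 1) (by positivity) (min_le_right _ _)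
  have h2 := h (min s₀ 1) (by positivity) (min_le_left _ _)
  have h3 : κ / (R ^ n * M + 1) * (R ^ n * M) ≤ κ := by
    rw [div_mul_eq_mul_div, div_le_iff₀ (by positivity)]
    nlinarith
  calc |U 1 - u x| = |(U 1 - U (min s₀ 1)) + (U (min s₀ 1) - u x)| := by ring_nf
    _ ≤ _ := (abs_add_le _ _).trans (by linarith)

lemma two_point {n : ℕ} (u : EuclideanSpace ℝ (Fin n) → ℝ) (w : Fin n → EuclideanSpace ℝ (Fin n) → ℝ)
    (hu : LocallyIntegrable u) (hw : ∀ j, LocallyIntegrable (w j))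
    (V : Set (EuclideanSpace ℝ (Fin n)))
    (hweak : ∀ φ : EuclideanSpace ℝ (Fin n) → ℝ, ContDiff ℝ (⊤ : ℕ∞) φ → HasCompactSupport φ →
      tsupport φ ⊆ V → ∀ j : Fin n,
      ∫ z, u z * fderiv ℝ φ z (EuclideanSpace.single j 1) = - ∫ z, w j z * φ z)
    (ε : ℝ) (x y : EuclideanSpace ℝ (Fin n)) (hxy : x ≠ y)
    (hVx : closedBall x ‖x - y‖ ⊆ V) (hVy : closedBall y ‖x - y‖ ⊆ V)
    (hLx : ∀ δ > 0, ∃ s₀ > 0, ∀ s, 0 < s → s ≤ s₀ →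
      ∫ z in closedBall x s, |u z - u x| ≤ δ * s ^ n)
    (hLy : ∀ δ > 0, ∃ s₀ > 0, ∀ s, 0 < s → s ≤ s₀ →
      ∫ z in closedBall y s, |u z - u y| ≤ δ * s ^ n)
    (hεx : ∀ s, 0 < s → s ≤ ‖x - y‖ → ∫ z in ball x s, ∑ j, |w j z| ≤ ε * s ^ n)
    (hεy : ∀ s, 0 < s → s ≤ ‖x - y‖ → ∫ z in ball y s, ∑ j, |w j z| ≤ ε * s ^ n) :
    |u x - u y| ≤ 2 * (4 ^ n / volume.real (ball (0 : EuclideanSpace ℝ (Fin n)) 1)) * ε * ‖x - y‖ := by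
  set d := ‖x - y‖ with hd
  have hd0 : 0 < d := norm_pos_iff.2 (sub_ne_zero.2 hxy)
  set v := volume.real (ball (0 : EuclideanSpace ℝ (Fin n)) 1) with hv
  have hv0 : 0 < v := ENNReal.toReal_pos (measure_ball_pos _ _ one_pos).ne' measure_ball_lt_top.ne
  let b : ContDiffBump (midpoint ℝ x y) := ⟨d / 4, d / 2, by positivity, by linarith⟩
  have hvol : volume.real (closedBall (midpoint ℝ x y) b.rIn) = (d / 4) ^ n * v := by
    rw [Measure.addHaar_real_closedBall _ _ b.rIn_pos.le]
    simp [b, hv]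
  have hM : ∀ z, b.normed volume z ≤ 1 / ((d / 4) ^ n * v) := by
    intro z
    rw [← hvol]
    exact b.normed_le_div_measure_closedBall_rIn volume z
  have hz : ∀ p, dist (midpoint ℝ x y) p ≤ d / 2 → ∀ z, z ∉ ball p d → b.normed volume z = 0 := by
    intro p hp z hz
    by_contra h
    have : z ∈ Function.support (b.normed volume) := h
    rw [b.support_normed_eq] at this
    apply hz
    have h1 : dist z (midpoint ℝ x y) < d / 2 := this
    have := dist_triangle z (midpoint ℝ x y) p
    rw [mem_ball]; linarith
  have hx : dist (midpoint ℝ x y) x ≤ d / 2 := by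
    rw [dist_midpoint_left, dist_eq_norm]; simp; linarith
  have hy : dist (midpoint ℝ x y) y ≤ d / 2 := by
    rw [dist_midpoint_right, dist_eq_norm]; simp; linarith
  have h1 := core u w hu hw V hweak x d hd0 hVx hLx ε hεx (b.normed volume) b.contDiff_normed _
    b.nonneg_normed hM (hz x hx) b.integral_normed
  have h2 := core u w hu hw V hweak y d hd0 hVy hLy ε hεy (b.normed volume) b.contDiff_normed _
    b.nonneg_normed hM (hz y hy) b.integral_normed
  have e : 1 / ((d / 4) ^ n * v) * d * ε * d ^ n = 4 ^ n / v * ε * d := by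
    rw [div_pow]; field_simp
  rw [e] at h1 h2
  rw [abs_le] at *
  constructor <;> linarith [h1.1, h1.2, h2.1, h2.2]

lemma leb_real {n : ℕ} {x : EuclideanSpace ℝ (Fin n)} {g : EuclideanSpace ℝ (Fin n) → ℝ} {a c : ℝ}
    (h : Tendsto (fun s : ℝ => ⨍ z in closedBall x s, g z) (𝓝[>] 0) (𝓝 a))
    (hc : a * volume.real (ball (0 : EuclideanSpace ℝ (Fin n)) 1) < c) :
    ∃ s₀ > 0, ∀ s, 0 < s → s ≤ s₀ → ∫ z in closedBall x s, g z ≤ c * s ^ n := by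
  have hv0 : 0 < volume.real (ball (0 : EuclideanSpace ℝ (Fin n)) 1) :=
    ENNReal.toReal_pos (measure_ball_pos _ _ one_pos).ne' measure_ball_lt_top.ne
  have h1 := (h.mul_const (volume.real (ball (0 : EuclideanSpace ℝ (Fin n)) 1))).eventually (gt_mem_nhds hc)
  obtain ⟨s₁, hs₁, h2⟩ := mem_nhdsGT_iff_exists_Ioo_subset.1 h1
  have hs₁' : (0:ℝ) < s₁ := hs₁
  refine ⟨s₁ / 2, by positivity, fun s hs hss => ?_⟩
  have h3 : (⨍ z in closedBall x s, g z) * _ < c := h2 (show s ∈ Ioo 0 s₁ from ⟨hs, by linarith⟩)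
  rw [setAverage_eq, Measure.addHaar_real_closedBall _ _ hs.le] at h3
  simp only [finrank_euclideanSpace, Fintype.card_fin, smul_eq_mul] at h3
  have : (s ^ n * volume.real (ball (0 : EuclideanSpace ℝ (Fin n)) 1))⁻¹ * (∫ z in closedBall x s, g z) *
      volume.real (ball (0 : EuclideanSpace ℝ (Fin n)) 1) = (∫ z in closedBall x s, g z) / s ^ n := by
    field_simp
  rw [this, div_lt_iff₀ (by positivity)] at h3
  exact h3.le

lemma leb_A {n : ℕ} (g : EuclideanSpace ℝ (Fin n) → ℝ) (hg : LocallyIntegrable g) :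
    ∀ᵐ x, ∀ c, g x * volume.real (ball (0 : EuclideanSpace ℝ (Fin n)) 1) < c →
    ∃ s₀ > 0, ∀ s, 0 < s → s ≤ s₀ → ∫ z in closedBall x s, g z ≤ c * s ^ n := by
  filter_upwards [IsUnifLocDoublingMeasure.ae_tendsto_average volume hg 1] with x hx c hc
  refine leb_real (hx (l := 𝓝[>] (0:ℝ)) (fun _ => x) (fun s => s) tendsto_id ?_) hc
  filter_upwards [self_mem_nhdsWithin] with s hs
  have : (0:ℝ) < s := hs
  simp [this.le]

lemma leb_B {n : ℕ} (g : EuclideanSpace ℝ (Fin n) → ℝ) (hg : LocallyIntegrable g) :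
    ∀ᵐ x, ∀ c > 0,
    ∃ s₀ > 0, ∀ s, 0 < s → s ≤ s₀ → ∫ z in closedBall x s, |g z - g x| ≤ c * s ^ n := by
  filter_upwards [IsUnifLocDoublingMeasure.ae_tendsto_average_norm_sub volume hg 1] with x hx c hc
  refine leb_real (hx (l := 𝓝[>] (0:ℝ)) (fun _ => x) (fun s => s) tendsto_id ?_) (by simpa using hc)
  filter_upwards [self_mem_nhdsWithin] with s hs
  have : (0:ℝ) < s := hs
  simp [this.le]

lemma closed_aux {n : ℕ} (g : EuclideanSpace ℝ (Fin n) → ℝ) (hg : LocallyIntegrable g)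
    (hg0 : ∀ z, 0 ≤ g z) (s c : ℝ) :
    IsClosed {x : EuclideanSpace ℝ (Fin n) | ∫ z in ball x s, g z ≤ c} := by
  have hI : ∀ x s, IntegrableOn g (ball x s) := fun x s =>
    (hg.integrableOn_isCompact (isCompact_closedBall x s)).mono_set ball_subset_closedBall
  refine isClosed_of_closure_subset fun x hx => ?_
  by_contra hcx
  have hcx : c < ∫ z in ball x s, g z := not_le.1 hcx
  have hU : (⋃ m : ℕ, ball x (s - 1 / ((m:ℝ) + 1))) = ball x s := by
    ext z
    simp only [mem_iUnion, mem_ball]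
    constructor
    · rintro ⟨m, hm⟩
      have : 0 < 1 / ((m:ℝ) + 1) := by positivity
      linarith
    · intro h
      obtain ⟨m, hm⟩ := exists_nat_one_div_lt (sub_pos.2 h)
      exact ⟨m, by linarith⟩
  have hmono : Monotone (fun m : ℕ => ball x (s - 1 / ((m:ℝ) + 1))) := by
    intro a b hab
    apply ball_subset_ball
    have : 1 / ((b:ℝ) + 1) ≤ 1 / ((a:ℝ) + 1) := Nat.one_div_le_one_div hab
    linarith
  have ht := tendsto_setIntegral_of_monotone (μ := volume) (f := g) (fun m : ℕ => measurableSet_ball) hmono (by rw [hU]; exact hI x s)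
  rw [hU] at ht
  obtain ⟨m, hm⟩ := (ht.eventually (lt_mem_nhds hcx)).exists
  obtain ⟨y, hy, hxy⟩ := Metric.mem_closure_iff.1 hx (1 / ((m:ℝ) + 1)) (by positivity)
  have hsub : ball x (s - 1 / ((m:ℝ) + 1)) ⊆ ball y s := by
    apply ball_subset_ball'
    linarith
  have := setIntegral_mono_set (hI y s) (Eventually.of_forall hg0) (LE.le.eventuallyLE hsub)
  have hy' : ∫ z in ball y s, g z ≤ c := hy
  linarith

lemma weak_linear {n : ℕ} (a : Fin n → ℝ) (φ : EuclideanSpace ℝ (Fin n) → ℝ)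
    (hφ : ContDiff ℝ (⊤ : ℕ∞) φ) (hc : HasCompactSupport φ) (j : Fin n) :
    ∫ z : EuclideanSpace ℝ (Fin n), (∑ k, a k * z k) * fderiv ℝ φ z (EuclideanSpace.single j 1)
      = - ∫ z, a j * φ z := by
  set T : EuclideanSpace ℝ (Fin n) →L[ℝ] ℝ := ∑ k, a k • (EuclideanSpace.proj k : EuclideanSpace ℝ (Fin n) →L[ℝ] ℝ) with hT
  have hTa : ∀ z, T z = ∑ k, a k * z k := by intro z; simp [hT]
  have hTj : T (EuclideanSpace.single j 1) = a j := by simp [hTa]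
  have h1 : Continuous (fun z => fderiv ℝ φ z (EuclideanSpace.single j 1)) :=
    (hφ.continuous_fderiv (by simp)).clm_apply continuous_const
  have := integral_mul_fderiv_eq_neg_fderiv_mul_of_integrable (μ := volume) (f := T) (g := φ)
    (v := EuclideanSpace.single j 1) ?_ ?_ ?_ (fun x _ => T.differentiableAt) (fun x _ => hφ.differentiable (by simp) x)
  · simpa [hTa, hTj] using this
  · simp only [ContinuousLinearMap.fderiv]
    exact (hφ.continuous.integrable_of_hasCompactSupport hc).const_mul _
  · exact (T.continuous.mul h1).integrable_of_hasCompactSupport ((hc.fderiv_apply ℝ _).mul_left)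
  · exact (T.continuous.mul hφ.continuous).integrable_of_hasCompactSupport hc.mul_left


lemma perL {n : ℕ} (f : EuclideanSpace ℝ (Fin n) → EuclideanSpace ℝ (Fin n))
    (Df : EuclideanSpace ℝ (Fin n) → Matrix (Fin n) (Fin n) ℝ)
    (hf : ∀ i, LocallyIntegrable (fun z => f z i))
    (hDf : ∀ i j, LocallyIntegrable (fun z => Df z i j))
    (c : EuclideanSpace ℝ (Fin n)) (ρ : ℝ)
    (hweak : ∀ φ : EuclideanSpace ℝ (Fin n) → ℝ, ContDiff ℝ (⊤ : ℕ∞) φ → HasCompactSupport φ →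
      tsupport φ ⊆ ball c ρ → ∀ i j : Fin n,
      ∫ z, f z i * fderiv ℝ φ z (EuclideanSpace.single j 1) = - ∫ z, Df z i j * φ z)
    (L : Matrix (Fin n) (Fin n) ℝ) (ε : ℝ) :
    ∃ S : Set (Set (EuclideanSpace ℝ (Fin n))), S.Countable ∧
      (∀ K ∈ S, MeasurableSet K ∧ K ⊆ ball c ρ ∧ ∀ x ∈ K, ∀ y ∈ K,
        ‖f x - f y - Matrix.toEuclideanLin L (x - y)‖ ≤
          n * (2 * (4 ^ n / volume.real (ball (0 : EuclideanSpace ℝ (Fin n)) 1)) * ε * ‖x - y‖)) ∧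
      ∀ᵐ x, x ∈ ball c ρ → (∑ i, ∑ j, |Df x i j - L i j|) *
        volume.real (ball (0 : EuclideanSpace ℝ (Fin n)) 1) < ε → x ∈ ⋃₀ S := by
  set v := volume.real (ball (0 : EuclideanSpace ℝ (Fin n)) 1) with hv
  set u : Fin n → EuclideanSpace ℝ (Fin n) → ℝ := fun i z => f z i - ∑ k, L i k * z k with hu
  set h : EuclideanSpace ℝ (Fin n) → ℝ := fun z => ∑ i, ∑ j, |Df z i j - L i j| with hh
  have hwl : ∀ i j, LocallyIntegrable (fun z => Df z i j - L i j) := fun i j =>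
    (hDf i j).sub (locallyIntegrable_const _)
  have hlin : ∀ i, Continuous (fun z : EuclideanSpace ℝ (Fin n) => ∑ k, L i k * z k) := by
    intro i; fun_prop
  have hul : ∀ i, LocallyIntegrable (u i) := fun i => (hf i).sub (hlin i).locallyIntegrable
  have hwabs : ∀ i j, LocallyIntegrable (fun z => |Df z i j - L i j|) := fun i j x => by
    obtain ⟨s, hs, hi⟩ := hwl i j x
    exact ⟨s, hs, hi.abs⟩
  have hhi : ∀ i, LocallyIntegrable (fun z => ∑ j, |Df z i j - L i j|) := fun i =>
    locallyIntegrable_finsetSum _ fun j _ => hwabs i j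
  have hhl : LocallyIntegrable h := locallyIntegrable_finsetSum _ fun i _ => hhi i
  have hh0 : ∀ z, 0 ≤ h z := fun z => Finset.sum_nonneg fun i _ => Finset.sum_nonneg fun j _ => abs_nonneg _
  have huweak : ∀ i, ∀ φ : EuclideanSpace ℝ (Fin n) → ℝ, ContDiff ℝ (⊤ : ℕ∞) φ → HasCompactSupport φ →
      tsupport φ ⊆ ball c ρ → ∀ j : Fin n,
      ∫ z, u i z * fderiv ℝ φ z (EuclideanSpace.single j 1) = - ∫ z, (Df z i j - L i j) * φ z := by
    intro i φ hφ hφc hφs j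
    have h1 : Continuous (fun z => fderiv ℝ φ z (EuclideanSpace.single j 1)) :=
      (hφ.continuous_fderiv (by simp)).clm_apply continuous_const
    have hint : ∀ g : EuclideanSpace ℝ (Fin n) → ℝ, Continuous g → HasCompactSupport g →
        ∀ v : EuclideanSpace ℝ (Fin n) → ℝ, LocallyIntegrable v → Integrable (fun z => v z * g z) := by
      intro g hg hgc v hv
      have := hv.integrable_smul_left_of_hasCompactSupport hg hgc
      simpa [mul_comm] using this
    simp only [hu, sub_mul]
    rw [integral_sub (hint _ h1 (hφc.fderiv_apply ℝ _) _ (hf i))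
      (hint _ h1 (hφc.fderiv_apply ℝ _) _ (hlin i).locallyIntegrable),
      integral_sub (hint _ hφ.continuous hφc _ (hDf i j))
      (hint _ hφ.continuous hφc _ (locallyIntegrable_const _)), hweak φ hφ hφc hφs i j,
      weak_linear (L i) φ hφ hφc j]
    ring
  have hgood : ∀ᵐ x, (∀ i, ∀ c > 0, ∃ s₀ > 0, ∀ s, 0 < s → s ≤ s₀ →
      ∫ z in closedBall x s, |u i z - u i x| ≤ c * s ^ n) :=
    ae_all_iff.2 fun i => leb_B (u i) (hul i)
  obtain ⟨G, hG, hGm, hGp⟩ := hgood.exists_measurable_mem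
  let r : ℕ → ℝ := fun k => 1 / ((k : ℝ) + 1)
  have hr : ∀ k, 0 < r k := fun k => by positivity
  let Q := TopologicalSpace.denseSeq (EuclideanSpace ℝ (Fin n))
  let K : ℕ × ℕ → Set (EuclideanSpace ℝ (Fin n)) := fun p =>
    (G ∩ closedBall c (ρ - r p.1)) ∩
      ((⋂ s ∈ Ioc 0 (r p.1), {x | ∫ z in ball x s, h z ≤ ε * s ^ n}) ∩ ball (Q p.2) (r p.1 / 2))
  refine ⟨range K, countable_range K, ?_, ?_⟩
  · rintro _ ⟨p, rfl⟩
    have hsubV : ∀ x ∈ K p, ∀ d < r p.1, closedBall x d ⊆ ball c ρ := by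
      intro x hx d hd z hz
      have h1 : dist x c ≤ ρ - r p.1 := hx.1.2
      have h2 : dist z x ≤ d := hz
      have := dist_triangle z x c
      rw [mem_ball]; linarith
    refine ⟨?_, ?_, ?_⟩
    · refine (hGm.inter measurableSet_closedBall).inter (MeasurableSet.inter ?_ measurableSet_ball)
      refine IsClosed.measurableSet ?_
      exact isClosed_biInter fun s _ => closed_aux h hhl hh0 s _
    · intro x hx
      exact hsubV x hx 0 (hr _) (mem_closedBall_self le_rfl)
    · intro x hx y hy
      by_cases hxy : x = y
      · subst hxy; simp
      have hd : ‖x - y‖ < r p.1 := by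
        have h1 : dist x (Q p.2) < r p.1 / 2 := hx.2.2
        have h2 : dist y (Q p.2) < r p.1 / 2 := hy.2.2
        rw [← dist_eq_norm]
        have := dist_triangle_right x y (Q p.2)
        linarith
      have hε : ∀ x ∈ K p, ∀ i, ∀ s, 0 < s → s ≤ r p.1 →
          ∫ z in ball x s, ∑ j, |Df z i j - L i j| ≤ ε * s ^ n := by
        intro x hx i s hs hsr
        have h1 : ∫ z in ball x s, h z ≤ ε * s ^ n := by
          have := mem_iInter₂.1 hx.2.1 s ⟨hs, hsr⟩
          exact this
        refine le_trans ?_ h1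
        have hI : ∀ g : EuclideanSpace ℝ (Fin n) → ℝ, LocallyIntegrable g → IntegrableOn g (ball x s) := fun g hg =>
          (hg.integrableOn_isCompact (isCompact_closedBall x s)).mono_set ball_subset_closedBall
        refine integral_mono (hI _ (hhi i)) (hI _ hhl) fun z => ?_
        exact Finset.single_le_sum (f := fun i => ∑ j, |Df z i j - L i j|)
          (fun i _ => Finset.sum_nonneg fun j _ => abs_nonneg _) (Finset.mem_univ i)
      have hcomp : ∀ i, |u i x - u i y| ≤ 2 * (4 ^ n / v) * ε * ‖x - y‖ := by
        intro i
        exact two_point (u i) (fun j z => Df z i j - L i j) (hul i) (hwl i) (ball c ρ) (huweak i) ε x y hxy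
          (hsubV x hx _ hd) (hsubV y hy _ hd) (hGp x hx.1.1 i) (hGp y hy.1.1 i)
          (fun s hs hs' => hε x hx i s hs (hs'.trans hd.le)) (fun s hs hs' => hε y hy i s hs (hs'.trans hd.le))
      have hnorm : ∀ w : EuclideanSpace ℝ (Fin n), ‖w‖ ≤ ∑ i, |w i| := by
        intro w
        conv_lhs => rw [← (EuclideanSpace.basisFun (Fin n) ℝ).sum_repr w]
        refine (norm_sum_le _ _).trans (le_of_eq ?_)
        simp [norm_smul]
      refine (hnorm _).trans ?_
      calc _ ≤ ∑ i : Fin n, 2 * (4 ^ n / v) * ε * ‖x - y‖ := by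
            refine Finset.sum_le_sum fun i _ => ?_
            have e : (f x - f y - Matrix.toEuclideanLin L (x - y)) i = u i x - u i y := by
              simp [hu, Matrix.toLpLin_apply, Matrix.mulVec, dotProduct, mul_sub, Finset.sum_sub_distrib]
              ring
            rw [e]; exact hcomp i
        _ = _ := by simp
  · filter_upwards [hG, leb_A h hhl] with x hxG hxh hxV hxε
    obtain ⟨s₀, hs₀, hs⟩ := hxh ε hxε
    have hpos : 0 < min s₀ (ρ - dist x c) := lt_min hs₀ (sub_pos.2 hxV)
    obtain ⟨k, hk⟩ := exists_nat_one_div_lt hpos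
    have hk' : r k < min s₀ (ρ - dist x c) := hk
    obtain ⟨m, hm⟩ := (TopologicalSpace.denseRange_denseSeq (EuclideanSpace ℝ (Fin n))).exists_dist_lt x (half_pos (hr k))
    refine mem_sUnion.2 ⟨K (k, m), mem_range_self _, ⟨hxG, ?_⟩, ?_, ?_⟩
    · have := hk'.trans_le (min_le_right _ _)
      show dist x c ≤ ρ - r k
      linarith
    · refine mem_iInter₂.2 fun s hss => ?_
      refine le_trans ?_ (hs s hss.1 (hss.2.trans (hk'.le.trans (min_le_left _ _))))
      exact setIntegral_mono_set (hhl.integrableOn_isCompact (isCompact_closedBall x s))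
        (Eventually.of_forall hh0) (LE.le.eventuallyLE ball_subset_closedBall)
    · exact hm

def BiLip {n : ℕ} (f : EuclideanSpace ℝ (Fin n) → EuclideanSpace ℝ (Fin n))
    (K : Set (EuclideanSpace ℝ (Fin n))) : Prop :=
  ∃ a b : ℝ, 0 < a ∧ ∀ x ∈ K, ∀ y ∈ K, ‖f x - f y‖ ≤ b * ‖x - y‖ ∧ a * ‖x - y‖ ≤ ‖f x - f y‖

lemma local_prop {n : ℕ} (f : EuclideanSpace ℝ (Fin n) → EuclideanSpace ℝ (Fin n))
    (Df : EuclideanSpace ℝ (Fin n) → Matrix (Fin n) (Fin n) ℝ)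
    (hf : ∀ i, LocallyIntegrable (fun z => f z i))
    (hDf : ∀ i j, LocallyIntegrable (fun z => Df z i j))
    (c : EuclideanSpace ℝ (Fin n)) (ρ : ℝ)
    (hweak : ∀ φ : EuclideanSpace ℝ (Fin n) → ℝ, ContDiff ℝ (⊤ : ℕ∞) φ → HasCompactSupport φ →
      tsupport φ ⊆ ball c ρ → ∀ i j : Fin n,
      ∫ z, f z i * fderiv ℝ φ z (EuclideanSpace.single j 1) = - ∫ z, Df z i j * φ z)
    (hdet : ∀ᵐ x, x ∈ ball c ρ → (Df x).det ≠ 0) :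
    ∃ S : Set (Set (EuclideanSpace ℝ (Fin n))), S.Countable ∧
      (∀ K ∈ S, MeasurableSet K ∧ K ⊆ ball c ρ ∧ BiLip f K) ∧
      ∀ᵐ x, x ∈ ball c ρ → x ∈ ⋃₀ S := by
  set v := volume.real (ball (0 : EuclideanSpace ℝ (Fin n)) 1) with hv
  have hv0 : 0 < v := ENNReal.toReal_pos (measure_ball_pos _ _ one_pos).ne' measure_ball_lt_top.ne
  set C : ℝ := n * (2 * (4 ^ n / v)) with hC
  have hC0 : 0 ≤ C := by positivity
  have hL : ∀ L : Matrix (Fin n) (Fin n) ℝ, ∃ ε : ℝ, 0 < ε ∧ (L.det ≠ 0 →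
      ∃ κ, 0 < κ ∧ C * ε ≤ κ / 2 ∧ ∀ w, κ * ‖w‖ ≤ ‖Matrix.toEuclideanLin L w‖) := by
    intro L
    by_cases hd : L.det = 0
    · exact ⟨1, one_pos, fun h => absurd hd h⟩
    have hinj : (Matrix.toEuclideanLin L).ker = ⊥ := by
      rw [LinearMap.ker_eq_bot']
      intro w hw
      have h1 : L.mulVec w.ofLp = 0 := by
        simpa [Matrix.toLpLin_apply] using hw
      have h2 := Matrix.eq_zero_of_mulVec_eq_zero hd h1
      ext i; simpa using congrFun h2 i
    obtain ⟨k, hk0, hk⟩ := (Matrix.toEuclideanLin L).exists_antilipschitzWith hinj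
    have hk0' : (0:ℝ) < k := hk0
    refine ⟨(k:ℝ)⁻¹ / (2 * (C + 1)), by positivity, fun _ => ⟨(k:ℝ)⁻¹, by positivity, ?_, ?_⟩⟩
    · rw [mul_div_assoc', div_le_div_iff₀ (by positivity) (by positivity)]
      have : 0 < (k:ℝ)⁻¹ := by positivity
      nlinarith
    · intro w
      rw [inv_mul_le_iff₀ hk0']
      simpa using hk.le_mul_dist w 0
  choose ε hε0 hε using hL
  choose S hSc hSK hSae using fun L => perL f Df hf hDf c ρ hweak L (ε L)
  have : SecondCountableTopology (Matrix (Fin n) (Fin n) ℝ) :=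
    inferInstanceAs (SecondCountableTopology (Fin n → Fin n → ℝ))
  obtain ⟨T, hTs, hTc, hTcov⟩ := TopologicalSpace.countable_cover_nhdsWithin
    (s := {L : Matrix (Fin n) (Fin n) ℝ | L.det ≠ 0})
    (f := fun L => {M | (∑ i, ∑ j, |M i j - L i j|) * v < ε L}) (by
      intro L _
      apply mem_nhdsWithin_of_mem_nhds
      refine IsOpen.mem_nhds (isOpen_lt (by fun_prop) continuous_const) ?_
      simpa using hε0 L)
  refine ⟨⋃ L ∈ T, S L, hTc.biUnion fun L _ => hSc L, ?_, ?_⟩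
  · intro K hK
    obtain ⟨L, hLT, hKL⟩ := mem_iUnion₂.1 hK
    obtain ⟨hm, hsub, hlip⟩ := hSK L K hKL
    obtain ⟨κ, hκ0, hκ, hκL⟩ := hε L (hTs hLT)
    refine ⟨hm, hsub, κ / 2, ‖LinearMap.toContinuousLinearMap (Matrix.toEuclideanLin L)‖ + κ / 2, by positivity, fun x hx y hy => ?_⟩
    have h1 : ‖f x - f y - Matrix.toEuclideanLin L (x - y)‖ ≤ κ / 2 * ‖x - y‖ := by
      refine (hlip x hx y hy).trans ?_
      calc _ = C * ε L * ‖x - y‖ := by rw [hC]; ring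
        _ ≤ _ := by gcongr
    have h2 := hκL (x - y)
    have h3 : ‖Matrix.toEuclideanLin L (x - y)‖ ≤ _ := (LinearMap.toContinuousLinearMap (Matrix.toEuclideanLin L)).le_opNorm (x - y)
    have h4 := norm_sub_norm_le (f x - f y) (Matrix.toEuclideanLin L (x - y))
    have h5 := norm_sub_norm_le (Matrix.toEuclideanLin L (x - y)) (f x - f y)
    rw [norm_sub_rev (Matrix.toEuclideanLin L (x - y)) (f x - f y)] at h5
    constructor <;> linarith
  · have hall : ∀ᵐ x, ∀ L ∈ T, x ∈ ball c ρ → (∑ i, ∑ j, |Df x i j - L i j|) * v < ε L → x ∈ ⋃₀ S L :=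
      (ae_ball_iff hTc).2 fun L _ => hSae L
    filter_upwards [hdet, hall] with x hx hxa hxV
    obtain ⟨L, hLT, hxL⟩ := mem_iUnion₂.1 (hTcov (hx hxV))
    obtain ⟨K, hK, hxK⟩ := mem_sUnion.1 (hxa L hLT hxV hxL)
    exact mem_sUnion.2 ⟨K, mem_iUnion₂.2 ⟨L, hLT, hK⟩, hxK⟩

lemma null_image {n : ℕ} (h : EuclideanSpace ℝ (Fin n) → EuclideanSpace ℝ (Fin n))
    (Z : Set (EuclideanSpace ℝ (Fin n))) (C : NNReal) (hl : LipschitzOnWith C h Z)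
    (hZ : volume Z = 0) : volume (h '' Z) = 0 := by
  have e := MeasureTheory.isAddHaarMeasure_hausdorffMeasure (E := EuclideanSpace ℝ (Fin n))
  have h1 := hl.hausdorffMeasure_image_le (d := (Module.finrank ℝ (EuclideanSpace ℝ (Fin n)) : ℝ)) (by positivity)
  have h2 : Measure.hausdorffMeasure (Module.finrank ℝ (EuclideanSpace ℝ (Fin n)) : ℝ) Z = 0 :=
    Measure.absolutelyContinuous_isAddHaarMeasure _ volume hZ
  rw [h2, mul_zero] at h1
  exact Measure.absolutelyContinuous_isAddHaarMeasure volume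
    (Measure.hausdorffMeasure (Module.finrank ℝ (EuclideanSpace ℝ (Fin n)) : ℝ)) (le_antisymm h1 bot_le)

lemma BiLip.mono {n : ℕ} {f : EuclideanSpace ℝ (Fin n) → EuclideanSpace ℝ (Fin n)}
    {K K' : Set (EuclideanSpace ℝ (Fin n))} (h : BiLip f K) (hs : K' ⊆ K) : BiLip f K' := by
  obtain ⟨a, b, ha, h⟩ := h
  exact ⟨a, b, ha, fun x hx y hy => h x (hs hx) y (hs hy)⟩

lemma BiLip.injOn {n : ℕ} {f : EuclideanSpace ℝ (Fin n) → EuclideanSpace ℝ (Fin n)}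
    {K : Set (EuclideanSpace ℝ (Fin n))} (h : BiLip f K) : InjOn f K := by
  obtain ⟨a, b, ha, h⟩ := h
  intro x hx y hy hxy
  have := (h x hx y hy).2
  rw [hxy, sub_self, norm_zero] at this
  have h2 : ‖x - y‖ ≤ 0 := by
    by_contra h3
    have := mul_pos ha (not_le.1 h3)
    linarith
  exact sub_eq_zero.1 (norm_le_zero_iff.1 h2)

lemma BiLip.continuousOn {n : ℕ} {f : EuclideanSpace ℝ (Fin n) → EuclideanSpace ℝ (Fin n)}
    {K : Set (EuclideanSpace ℝ (Fin n))} (h : BiLip f K) : ContinuousOn f K := by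
  obtain ⟨a, b, ha, h⟩ := h
  refine (LipschitzOnWith.of_dist_le_mul (K := b.toNNReal) fun x hx y hy => ?_).continuousOn
  rw [dist_eq_norm, dist_eq_norm]
  refine (h x hx y hy).1.trans ?_
  gcongr
  exact Real.le_coe_toNNReal b

lemma BiLip.null_transfer {n : ℕ} {f : EuclideanSpace ℝ (Fin n) → EuclideanSpace ℝ (Fin n)}
    {K K' Z : Set (EuclideanSpace ℝ (Fin n))} (h : BiLip f K) (h' : BiLip f K') (hZK : Z ⊆ K)
    (hZ : volume Z = 0) : volume (K' ∩ f ⁻¹' (f '' Z)) = 0 := by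
  have hinj := h'.injOn
  obtain ⟨a, b, ha, h⟩ := h
  obtain ⟨a', b', ha', h'⟩ := h'
  set Z' := Z ∩ f ⁻¹' (f '' K') with hZ'
  have hex : ∀ z, ∃ y, z ∈ Z' → y ∈ K' ∧ f y = f z := by
    intro z
    by_cases hz : z ∈ Z'
    · obtain ⟨y, hy, e⟩ := hz.2
      exact ⟨y, fun _ => ⟨hy, e⟩⟩
    · exact ⟨z, fun h => absurd h hz⟩
  choose g hg using hex
  have hlip : LipschitzOnWith (b / a').toNNReal g Z' := by
    refine LipschitzOnWith.of_dist_le_mul fun x hx y hy => ?_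
    rw [dist_eq_norm, dist_eq_norm]
    have h1 := (h' _ (hg x hx).1 _ (hg y hy).1).2
    rw [(hg x hx).2, (hg y hy).2] at h1
    have h2 := (h x (hZK hx.1) y (hZK hy.1)).1
    have h3 : ‖g x - g y‖ ≤ b / a' * ‖x - y‖ := by
      rw [div_mul_eq_mul_div, le_div_iff₀ ha']
      linarith
    refine h3.trans ?_
    gcongr
    exact Real.le_coe_toNNReal _
  refine measure_mono_null ?_ (null_image g Z' _ hlip (measure_mono_null inter_subset_left hZ))
  rintro y ⟨hy, z, hz, e⟩
  have hz' : z ∈ Z' := ⟨hz, y, hy, e.symm⟩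
  exact ⟨z, hz', hinj (hg z hz').1 hy ((hg z hz').2.trans e)⟩

lemma BiLip.meas_preimage {n : ℕ} {f : EuclideanSpace ℝ (Fin n) → EuclideanSpace ℝ (Fin n)}
    {K T : Set (EuclideanSpace ℝ (Fin n))} (h : BiLip f K) (hK : MeasurableSet K)
    (hT : MeasurableSet T) : MeasurableSet (K ∩ f ⁻¹' T) := by
  have h1 : Measurable (K.domRestrict f) := (continuousOn_iff_continuous_domRestrict.1 h.continuousOn).measurable
  have h2 := hK.subtype_image (h1 hT)
  convert h2 using 1
  ext z; simp [Set.domRestrict, and_comm]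

lemma BiLip.transfer {n : ℕ} {f : EuclideanSpace ℝ (Fin n) → EuclideanSpace ℝ (Fin n)}
    {K K' E : Set (EuclideanSpace ℝ (Fin n))} (h : BiLip f K) (h' : BiLip f K')
    (hK' : MeasurableSet K') (hE : E ⊆ K)
    (hEf : f '' E ⊆ f '' K') (hEm : NullMeasurableSet E) (hE0 : 0 < volume E) :
    NullMeasurableSet (K' ∩ f ⁻¹' (f '' E)) ∧ 0 < volume (K' ∩ f ⁻¹' (f '' E)) ∧
      f '' E = f '' (K' ∩ f ⁻¹' (f '' E)) := by
  have e : f '' E = f '' (K' ∩ f ⁻¹' (f '' E)) := by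
    rw [image_inter_preimage, inter_eq_right.2 hEf]
  refine ⟨?_, ?_, e⟩
  · obtain ⟨E', hE's, hE'm, hae⟩ := hEm.exists_measurable_subset_ae_eq
    have hE'K := hE's.trans hE
    have h1 : MeasurableSet (K' ∩ f ⁻¹' (f '' E')) := h'.meas_preimage hK'
      (hE'm.image_of_continuousOn_injOn (h.continuousOn.mono hE'K) (h.injOn.mono hE'K))
    have h2 : volume (K' ∩ f ⁻¹' (f '' (E \ E'))) = 0 :=
      h.null_transfer h' (sdiff_subset.trans hE) (ae_le_set.1 hae.symm.le)
    have h3 : K' ∩ f ⁻¹' (f '' E) = (K' ∩ f ⁻¹' (f '' E')) ∪ (K' ∩ f ⁻¹' (f '' (E \ E'))) := by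
      rw [← inter_union_distrib_left, ← preimage_union, ← image_union, union_sdiff_cancel hE's]
    rw [h3]
    exact h1.nullMeasurableSet.union (NullMeasurableSet.of_null h2)
  · rw [pos_iff_ne_zero]
    intro h0
    have h1 := h'.null_transfer h (Z := K' ∩ f ⁻¹' (f '' E)) inter_subset_left h0
    rw [← e] at h1
    have h2 : E ⊆ K ∩ f ⁻¹' (f '' E) := fun z hz => ⟨hE hz, mem_image_of_mem f hz⟩
    exact hE0.ne' (measure_mono_null h2 h1)


lemma global_prop (n : ℕ) (Ω : Set (EuclideanSpace ℝ (Fin n)))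
    (hΩopen : IsOpen Ω)
    (f : EuclideanSpace ℝ (Fin n) → EuclideanSpace ℝ (Fin n))
    (Df : EuclideanSpace ℝ (Fin n) → Matrix (Fin n) (Fin n) ℝ)
    (hf : MemW11loc n Ω f Df)
    (hJ : ∀ᵐ x ∂(volume.restrict Ω), 0 < (Df x).det) :
    ∃ S : Set (Set (EuclideanSpace ℝ (Fin n))), S.Countable ∧
      (∀ K ∈ S, MeasurableSet K ∧ K ⊆ Ω ∧ BiLip f K) ∧
      ∀ᵐ x, x ∈ Ω → x ∈ ⋃₀ S := by
  obtain ⟨hf1, hf2, hf3⟩ := hf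
  have hJ' : ∀ᵐ x, x ∈ Ω → 0 < (Df x).det := (ae_restrict_iff' hΩopen.measurableSet).1 hJ
  have hloc : ∀ c, ∃ ρ : ℝ, 0 < ρ ∧ (c ∈ Ω → closedBall c ρ ⊆ Ω) := by
    intro c
    by_cases hc : c ∈ Ω
    · obtain ⟨ρ, h0, h⟩ := Metric.nhds_basis_closedBall.mem_iff.1 (hΩopen.mem_nhds hc)
      exact ⟨ρ, h0, fun _ => h⟩
    · exact ⟨1, one_pos, fun h => absurd h hc⟩
  choose ρ hρ0 hρ using hloc
  have hball : ∀ c ∈ Ω, ∃ S : Set (Set (EuclideanSpace ℝ (Fin n))), S.Countable ∧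
      (∀ K ∈ S, MeasurableSet K ∧ K ⊆ ball c (ρ c) ∧ BiLip f K) ∧
      ∀ᵐ x, x ∈ ball c (ρ c) → x ∈ ⋃₀ S := by
    intro c hc
    have hBΩ : ball c (ρ c) ⊆ Ω := ball_subset_closedBall.trans (hρ c hc)
    have hi : ∀ i, (fun z => ((ball c (ρ c)).indicator f z) i) = (ball c (ρ c)).indicator (fun z => f z i) := by
      intro i; ext z
      by_cases hz : z ∈ ball c (ρ c) <;> simp [hz]
    have hij : ∀ i j, (fun z => ((ball c (ρ c)).indicator Df z) i j) = (ball c (ρ c)).indicator (fun z => Df z i j) := by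
      intro i j; ext z
      by_cases hz : z ∈ ball c (ρ c) <;> simp [hz]
    have hlp := local_prop ((ball c (ρ c)).indicator f) ((ball c (ρ c)).indicator Df)
      (ρ := ρ c) (c := c)
    specialize hlp ?_ ?_ ?_ ?_
    rotate_right
    · obtain ⟨S, hS, hSK, hSae⟩ := hlp
      refine ⟨S, hS, fun K hK => ⟨(hSK K hK).1, (hSK K hK).2.1, ?_⟩, hSae⟩
      obtain ⟨a, b, ha, h⟩ := (hSK K hK).2.2
      refine ⟨a, b, ha, fun x hx y hy => ?_⟩
      have := h x hx y hy
      rwa [indicator_of_mem ((hSK K hK).2.1 hx), indicator_of_mem ((hSK K hK).2.1 hy)] at this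
    · intro i
      rw [hi]
      apply Integrable.locallyIntegrable
      rw [integrable_indicator_iff measurableSet_ball]
      have h1 : IntegrableOn f (ball c (ρ c)) :=
        (hf1.integrableOn_compact_subset (hρ c hc) (isCompact_closedBall _ _)).mono_set ball_subset_closedBall
      exact (EuclideanSpace.proj i : EuclideanSpace ℝ (Fin n) →L[ℝ] ℝ).integrable_comp h1
    · intro i j
      rw [hij]
      apply Integrable.locallyIntegrable
      rw [integrable_indicator_iff measurableSet_ball]
      exact ((hf2 i j).integrableOn_compact_subset (hρ c hc) (isCompact_closedBall _ _)).mono_set ball_subset_closedBall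
    · intro φ hφ hφc hφs i j
      have h := hf3 φ hφ hφc (hφs.trans hBΩ) i j
      have hd0 : ∀ z, z ∉ ball c (ρ c) → fderiv ℝ φ z = 0 := by
        intro z hz
        by_contra h
        exact hz (hφs (support_fderiv_subset ℝ h))
      have hφ0 : ∀ z, z ∉ ball c (ρ c) → φ z = 0 := fun z hz =>
        image_eq_zero_of_notMem_tsupport fun h => hz (hφs h)
      rw [setIntegral_eq_integral_of_forall_compl_eq_zero
          (fun z hz => by rw [hd0 z (fun h => hz (hBΩ h))]; simp),
        setIntegral_eq_integral_of_forall_compl_eq_zero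
          (fun z hz => by rw [hφ0 z (fun h => hz (hBΩ h))]; simp)] at h
      convert h using 2
      · ext z
        by_cases hz : z ∈ ball c (ρ c)
        · rw [indicator_of_mem hz]
        · rw [hd0 z hz]; simp
      · congr 1
        ext z
        by_cases hz : z ∈ ball c (ρ c)
        · rw [indicator_of_mem hz]
        · rw [hφ0 z hz]; simp
    · filter_upwards [hJ'] with x hx hxB
      rw [indicator_of_mem hxB]
      exact (hx (hBΩ hxB)).ne'
  choose! S hS hSK hSae using hball
  obtain ⟨T, hTs, hTc, hTcov⟩ := TopologicalSpace.countable_cover_nhdsWithin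
    (s := Ω) (f := fun c => ball c (ρ c))
    (fun c _ => mem_nhdsWithin_of_mem_nhds (ball_mem_nhds c (hρ0 c)))
  refine ⟨⋃ c ∈ T, S c, hTc.biUnion fun c hc => hS c (hTs hc), ?_, ?_⟩
  · intro K hK
    obtain ⟨c, hcT, hKc⟩ := mem_iUnion₂.1 hK
    obtain ⟨h1, h2, h3⟩ := hSK c (hTs hcT) K hKc
    exact ⟨h1, h2.trans (ball_subset_closedBall.trans (hρ c (hTs hcT))), h3⟩
  · have hall : ∀ᵐ x, ∀ c ∈ T, x ∈ ball c (ρ c) → x ∈ ⋃₀ S c :=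
      (ae_ball_iff hTc).2 fun c hc => hSae c (hTs hc)
    filter_upwards [hall] with x hxa hxV
    obtain ⟨c, hcT, hxc⟩ := mem_iUnion₂.1 (hTcov hxV)
    obtain ⟨K, hK, hxK⟩ := mem_sUnion.1 (hxa c hcT hxc)
    exact mem_sUnion.2 ⟨K, mem_iUnion₂.2 ⟨c, hcT, hK⟩, hxK⟩


/-- If `f ∈ W^{1,1}_loc(Ω, ℝⁿ)` has `J_f > 0` a.e. and is not injective almost everywhere,
then there are disjoint Lebesgue measurable sets `A, B ⊆ Ω` of positive measure with
`f(A) = f(B)`; moreover `A` and `B` can be chosen so that every positive-measure measurable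
subset of one of them has a positive-measure measurable counterpart in the other with the
same image. -/
theorem not_injective_ae_implies_two_sets
    (n : ℕ) (Ω : Set (EuclideanSpace ℝ (Fin n)))
    (hΩopen : IsOpen Ω) (hΩconn : IsConnected Ω)
    (f : EuclideanSpace ℝ (Fin n) → EuclideanSpace ℝ (Fin n))
    (Df : EuclideanSpace ℝ (Fin n) → Matrix (Fin n) (Fin n) ℝ)
    (hf : MemW11loc n Ω f Df)
    (hJ : ∀ᵐ x ∂(volume.restrict Ω), 0 < (Df x).det)
    (hnotinj : ¬ ∃ N : Set (EuclideanSpace ℝ (Fin n)), N ⊆ Ω ∧ volume N = 0 ∧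
      Set.InjOn f (Ω \ N)) :
    ∃ A B : Set (EuclideanSpace ℝ (Fin n)),
      A ⊆ Ω ∧ B ⊆ Ω ∧
      NullMeasurableSet A volume ∧ NullMeasurableSet B volume ∧
      0 < volume A ∧ 0 < volume B ∧ A ∩ B = ∅ ∧ f '' A = f '' B ∧
      (∀ E : Set (EuclideanSpace ℝ (Fin n)), E ⊆ A → NullMeasurableSet E volume →
        0 < volume E → ∃ F : Set (EuclideanSpace ℝ (Fin n)), F ⊆ B ∧
          NullMeasurableSet F volume ∧ 0 < volume F ∧ f '' E = f '' F) ∧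
      (∀ E : Set (EuclideanSpace ℝ (Fin n)), E ⊆ B → NullMeasurableSet E volume →
        0 < volume E → ∃ F : Set (EuclideanSpace ℝ (Fin n)), F ⊆ A ∧
          NullMeasurableSet F volume ∧ 0 < volume F ∧ f '' E = f '' F) := by
  obtain ⟨S, hSc, hSK, hSae⟩ := global_prop n Ω hΩopen f Df hf hJ
  obtain ⟨K₀, hK₀⟩ := (hSc.union (countable_singleton ∅)).exists_eq_range ⟨∅, Or.inr rfl⟩
  have hK₀p : ∀ k, MeasurableSet (K₀ k) ∧ K₀ k ⊆ Ω ∧ BiLip f (K₀ k) := by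
    intro k
    have : K₀ k ∈ S ∪ {∅} := by rw [hK₀]; exact mem_range_self k
    rcases this with h | h
    · exact hSK _ h
    · rw [mem_singleton_iff.1 h]
      exact ⟨MeasurableSet.empty, empty_subset _, 1, 1, one_pos, fun x hx => absurd hx (notMem_empty x)⟩
  set K := disjointed K₀ with hK
  have hKm : ∀ k, MeasurableSet (K k) := MeasurableSet.disjointed fun k => (hK₀p k).1
  have hKΩ : ∀ k, K k ⊆ Ω := fun k => (disjointed_subset K₀ k).trans (hK₀p k).2.1
  have hKb : ∀ k, BiLip f (K k) := fun k => (hK₀p k).2.2.mono (disjointed_subset K₀ k)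
  have hKU : ∀ᵐ x, x ∈ Ω → ∃ k, x ∈ K k := by
    filter_upwards [hSae] with x hx hxΩ
    obtain ⟨T, hT, hxT⟩ := mem_sUnion.1 (hx hxΩ)
    have : T ∈ range K₀ := by rw [← hK₀]; exact Or.inl hT
    obtain ⟨k, rfl⟩ := this
    have h2 : x ∈ ⋃ k, K k := by
      rw [hK, iUnion_disjointed]; exact mem_iUnion.2 ⟨k, hxT⟩
    exact mem_iUnion.1 h2
  have key : ∃ i j, i ≠ j ∧ volume (K i ∩ f ⁻¹' (f '' K j)) ≠ 0 := by
    by_contra hcon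
    push Not at hcon
    apply hnotinj
    refine ⟨(Ω ∩ {x | ¬ (x ∈ Ω → ∃ k, x ∈ K k)}) ∪ ⋃ i, ⋃ j, ⋃ (_ : i ≠ j), K i ∩ f ⁻¹' (f '' K j), ?_, ?_, ?_⟩
    · refine union_subset inter_subset_left ?_
      refine iUnion_subset fun i => iUnion_subset fun j => iUnion_subset fun _ => ?_
      exact inter_subset_left.trans (hKΩ i)
    · refine measure_union_null (measure_mono_null inter_subset_right hKU) ?_
      refine measure_iUnion_null fun i => measure_iUnion_null fun j => measure_iUnion_null fun h => hcon i j h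
    · rintro x ⟨hxΩ, hx⟩ y ⟨hyΩ, hy⟩ hxy
      have hex : ∀ z ∈ Ω, z ∉ (Ω ∩ {x | ¬ (x ∈ Ω → ∃ k, x ∈ K k)}) ∪ (⋃ i, ⋃ j, ⋃ (_ : i ≠ j), K i ∩ f ⁻¹' (f '' K j)) →
          ∃ k, z ∈ K k := by
        intro z hz hzn
        by_contra h
        exact hzn (Or.inl ⟨hz, fun h' => h (h' hz)⟩)
      obtain ⟨i, hi⟩ := hex x hxΩ hx
      obtain ⟨j, hj⟩ := hex y hyΩ hy
      by_cases hij : i = j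
      · subst hij
        exact (hKb i).injOn hi hj hxy
      · exfalso
        apply hx
        right
        exact mem_iUnion.2 ⟨i, mem_iUnion.2 ⟨j, mem_iUnion.2 ⟨hij, hi, y, hj, hxy.symm⟩⟩⟩
  obtain ⟨i, j, hij, hpos⟩ := key
  have himg : ∀ k, MeasurableSet (f '' K k) := fun k =>
    (hKm k).image_of_continuousOn_injOn (hKb k).continuousOn (hKb k).injOn
  have hAm : ∀ i j, MeasurableSet (K i ∩ f ⁻¹' (f '' K j)) := fun i j =>
    (hKb i).meas_preimage (hKm i) (himg j)
  have hAi : ∀ i j, f '' (K i ∩ f ⁻¹' (f '' K j)) = f '' K i ∩ f '' K j := fun i j =>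
    image_inter_preimage _ _ _
  have hAB : ∀ i j E, E ⊆ K i ∩ f ⁻¹' (f '' K j) → NullMeasurableSet E volume → 0 < volume E →
      ∃ F ⊆ K j ∩ f ⁻¹' (f '' K i), NullMeasurableSet F volume ∧ 0 < volume F ∧ f '' E = f '' F := by
    intro i j E hE hEm hE0
    have hEi : E ⊆ K i := hE.trans inter_subset_left
    have hEj : f '' E ⊆ f '' K j := by
      rintro _ ⟨z, hz, rfl⟩
      exact (hE hz).2
    obtain ⟨h1, h2, h3⟩ := (hKb i).transfer (hKb j) (hKm j) hEi hEj hEm hE0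
    exact ⟨_, inter_subset_inter_right _ (preimage_mono (image_mono hEi)), h1, h2, h3⟩
  have hApos : 0 < volume (K i ∩ f ⁻¹' (f '' K j)) := pos_iff_ne_zero.2 hpos
  refine ⟨K i ∩ f ⁻¹' (f '' K j), K j ∩ f ⁻¹' (f '' K i), inter_subset_left.trans (hKΩ i),
    inter_subset_left.trans (hKΩ j), (hAm i j).nullMeasurableSet, (hAm j i).nullMeasurableSet,
    hApos, ?_, ?_, ?_, hAB i j, hAB j i⟩
  · obtain ⟨F, hF, _, hF0, _⟩ := hAB i j _ Subset.rfl (hAm i j).nullMeasurableSet hApos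
    exact hF0.trans_le (measure_mono hF)
  · have hd : Disjoint (K i) (K j) := disjoint_disjointed K₀ hij
    exact (hd.mono inter_subset_left inter_subset_left).inter_eq
  · rw [hAi, hAi, inter_comm]
end

section
/- Let Ω ⊆ ℝⁿ be open and let f ∈ W^{1,1}_loc(Ω,ℝⁿ). Then f is approximately differentiable almost everywhere in the following L¹ sense: for almost every x ∈ Ω, with Df(x) the weak derivative at x, the averaged linearization error satisfies lim_{r→0} ⨍_{B(x,r)∩Ω} |f(y) − f(x) − Df(x)·(y−x)| / r dy = 0, where ⨍ denotes the average integral over B(x,r)∩Ω. -/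
open MeasureTheory Filter Metric Set
open scoped ENNReal Topology

lemma aux_scale {n : ℕ} (H : EuclideanSpace ℝ (Fin n) → ℝ≥0∞) (hH : Measurable H) {t : ℝ} (ht : 0 < t)
    (a : EuclideanSpace ℝ (Fin n)) :
    ∫⁻ y, H (t • y + a) = ENNReal.ofReal ((t ^ n)⁻¹) * ∫⁻ y, H y := by
  have h1 := Measure.map_addHaar_smul (volume : Measure (EuclideanSpace ℝ (Fin n))) ht.ne'
  have h2 : ∫⁻ y, H (t • y + a) = ∫⁻ z, H (z + a) ∂(Measure.map (t • ·) volume) := by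
    rw [lintegral_map (by fun_prop) (by fun_prop)]
  rw [h2, h1, lintegral_smul_measure, lintegral_add_right_eq_self]
  simp [abs_of_pos ht]

lemma aux_vol {n : ℕ} (x : EuclideanSpace ℝ (Fin n)) {r : ℝ} (hr : 0 < r) :
    volume (closedBall x r) = ENNReal.ofReal (r ^ n) * volume (ball (0 : EuclideanSpace ℝ (Fin n)) 1) := by
  rw [Measure.addHaar_closedBall _ _ hr.le]; simp

lemma aux_vol' {n : ℕ} (x : EuclideanSpace ℝ (Fin n)) {r : ℝ} (hr : 0 < r) :
    volume (ball x r) = ENNReal.ofReal (r ^ n) * volume (ball (0 : EuclideanSpace ℝ (Fin n)) 1) := by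
  rw [Measure.addHaar_ball_of_pos _ _ hr]; simp

lemma aux_B {n : ℕ} (K ρ : EuclideanSpace ℝ (Fin n) → ℝ≥0∞) (hK : Measurable K) (hρ : Measurable ρ)
    (x : EuclideanSpace ℝ (Fin n)) {ε r t s₀ : ℝ} (hε : 0 < ε) (hr : 0 < r) (ht : 0 < t) (ht1 : t ≤ 1)
    (hεs : 2 * ε ≤ s₀) (hrs : 2 * r ≤ s₀) {δ M C : ℝ≥0∞}
    (hρ1 : ∫⁻ v, ρ v = 1) (hρ0 : ∀ v, ε < ‖v‖ → ρ v = 0) (hρM : ∀ v, ρ v ≤ M)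
    (hC1 : 1 ≤ C)
    (hMC : M * volume (closedBall (0 : EuclideanSpace ℝ (Fin n)) ε) ≤ C)
    (hL : ∀ σ, 0 < σ → σ ≤ s₀ → ∫⁻ y in closedBall x σ, K y ≤ δ * volume (closedBall x σ)) :
    ∫⁻ y in ball x r, ∫⁻ v, ρ v * K (x + t • (y - x) - v)
      ≤ C * ENNReal.ofReal (2 ^ n) * δ * volume (ball x r) := by
  rcases le_total ε (t * r) with h | h
  · rw [lintegral_lintegral_swap (by fun_prop)]
    have key : ∀ v, ∫⁻ y in ball x r, ρ v * K (x + t • (y - x) - v)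
        ≤ ρ v * (ENNReal.ofReal (2 ^ n) * δ * volume (ball x r)) := by
      intro v
      by_cases hv : ε < ‖v‖
      · simp [hρ0 v hv]
      push Not at hv
      rw [lintegral_const_mul _ (by fun_prop)]
      gcongr
      set H := (closedBall x (2 * (t * r))).indicator K with hH
      have hHm : Measurable H := hK.indicator measurableSet_closedBall
      calc ∫⁻ y in ball x r, K (x + t • (y - x) - v)
          ≤ ∫⁻ y in ball x r, H (t • y + (x - t • x - v)) := by
            refine setLIntegral_mono (by fun_prop) fun y hy => ?_
            have e : x + t • (y - x) - v = t • y + (x - t • x - v) := by rw [smul_sub]; abel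
            rw [← e, hH, indicator_of_mem]
            rw [mem_closedBall, dist_eq_norm]
            rw [mem_ball, dist_eq_norm] at hy
            calc ‖x + t • (y - x) - v - x‖ = ‖t • (y - x) - v‖ := by congr 1; abel
              _ ≤ ‖t • (y - x)‖ + ‖v‖ := norm_sub_le _ _
              _ ≤ t * r + t * r := by
                rw [norm_smul, Real.norm_of_nonneg ht.le]; gcongr; linarith
              _ = _ := by ring
        _ ≤ ∫⁻ y, H (t • y + (x - t • x - v)) := setLIntegral_le_lintegral _ _
        _ = ENNReal.ofReal ((t ^ n)⁻¹) * ∫⁻ y in closedBall x (2 * (t * r)), K y := by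
            rw [aux_scale H hHm ht, hH, lintegral_indicator measurableSet_closedBall]
        _ ≤ ENNReal.ofReal ((t ^ n)⁻¹) * (δ * volume (closedBall x (2 * (t * r)))) := by
            gcongr
            exact hL _ (by positivity) (by nlinarith)
        _ = _ := by
            rw [aux_vol _ (by positivity), aux_vol' _ hr]
            have : ENNReal.ofReal ((2 * (t * r)) ^ n)
              = ENNReal.ofReal (2 ^ n) * ENNReal.ofReal (t ^ n) * ENNReal.ofReal (r ^ n) := by
              rw [← ENNReal.ofReal_mul (by positivity), ← ENNReal.ofReal_mul (by positivity)]
              congr 1; ring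
            have e2 : ENNReal.ofReal ((t ^ n)⁻¹) * ENNReal.ofReal (t ^ n) = 1 := by
              rw [← ENNReal.ofReal_mul (by positivity), inv_mul_cancel₀ (by positivity)]; simp
            rw [this]
            calc _ = (ENNReal.ofReal ((t ^ n)⁻¹) * ENNReal.ofReal (t ^ n)) * (ENNReal.ofReal (2 ^ n) * δ * (ENNReal.ofReal (r ^ n) * volume (ball (0 : EuclideanSpace ℝ (Fin n)) 1))) := by ring
              _ = _ := by rw [e2, one_mul]
    calc _ ≤ ∫⁻ v, ρ v * (ENNReal.ofReal (2 ^ n) * δ * volume (ball x r)) := lintegral_mono key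
      _ = 1 * (ENNReal.ofReal (2 ^ n) * δ * volume (ball x r)) := by
        rw [lintegral_mul_const _ hρ, hρ1]
      _ ≤ C * (ENNReal.ofReal (2 ^ n) * δ * volume (ball x r)) := by gcongr
      _ = _ := by ring
  · have key : ∀ y ∈ ball x r, ∫⁻ v, ρ v * K (x + t • (y - x) - v)
        ≤ C * ENNReal.ofReal (2 ^ n) * δ := by
      intro y hy
      rw [mem_ball, dist_eq_norm] at hy
      set z := x + t • (y - x) with hz
      set H := (closedBall x (2 * ε)).indicator K with hH
      have hHm : Measurable H := hK.indicator measurableSet_closedBall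
      calc ∫⁻ v, ρ v * K (z - v) ≤ ∫⁻ v, M * H (z - v) := by
            refine lintegral_mono fun v => ?_
            by_cases hv : ε < ‖v‖
            · simp [hρ0 v hv]
            push Not at hv
            dsimp only
            rw [hH, indicator_of_mem]
            · gcongr; exact hρM v
            rw [mem_closedBall, dist_eq_norm]
            calc ‖z - v - x‖ = ‖t • (y - x) - v‖ := by congr 1; rw [hz]; abel
              _ ≤ ‖t • (y - x)‖ + ‖v‖ := norm_sub_le _ _
              _ ≤ t * r + ε := by
                rw [norm_smul, Real.norm_of_nonneg ht.le]; gcongr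
              _ ≤ _ := by linarith
        _ = M * ∫⁻ y in closedBall x (2 * ε), K y := by
            rw [lintegral_const_mul _ (by fun_prop), lintegral_sub_left_eq_self, hH,
              lintegral_indicator measurableSet_closedBall]
        _ ≤ M * (δ * volume (closedBall x (2 * ε))) := by
            gcongr; exact hL _ (by positivity) hεs
        _ = (M * volume (closedBall (0 : EuclideanSpace ℝ (Fin n)) ε)) * ENNReal.ofReal (2 ^ n) * δ := by
            rw [aux_vol _ (by positivity), aux_vol _ hε, mul_pow, ENNReal.ofReal_mul (by positivity)]
            ring
        _ ≤ _ := by gcongr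
    calc _ ≤ ∫⁻ y in ball x r, C * ENNReal.ofReal (2 ^ n) * δ :=
          setLIntegral_mono measurable_const key
      _ = _ := by simp

lemma aux_A {n : ℕ} (F : EuclideanSpace ℝ (Fin n) → EuclideanSpace ℝ (Fin n)) (hF : ContDiff ℝ 1 F)
    (D : EuclideanSpace ℝ (Fin n) →L[ℝ] EuclideanSpace ℝ (Fin n))
    (N : EuclideanSpace ℝ (Fin n) → ℝ≥0∞) (hN : Measurable N)
    (x : EuclideanSpace ℝ (Fin n)) {r : ℝ}
    (hFN : ∀ z ∈ ball x r, ‖fderiv ℝ F z - D‖ₑ ≤ N z) :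
    ∫⁻ y in ball x r, ‖F y - F x - D (y - x)‖ₑ ≤
      ENNReal.ofReal r * ∫⁻ t in Ioc (0 : ℝ) 1, ∫⁻ y in ball x r, N (x + t • (y - x)) := by
  have key : ∀ y ∈ ball x r, ‖F y - F x - D (y - x)‖ₑ ≤
      ENNReal.ofReal r * ∫⁻ t in Ioc (0 : ℝ) 1, N (x + t • (y - x)) := by
    intro y hy
    have hy' := hy
    rw [mem_ball, dist_eq_norm] at hy
    have hc : Continuous (fderiv ℝ F) := hF.continuous_fderiv (by norm_num)
    have hd : ∀ t ∈ uIcc (0 : ℝ) 1, HasDerivAt (fun t : ℝ => F (x + t • (y - x)) - t • D (y - x))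
        ((fderiv ℝ F (x + t • (y - x)) - D) (y - x)) t := by
      intro t _
      have h1 : HasDerivAt (fun t : ℝ => x + t • (y - x)) (y - x) t := by
        simpa using ((hasDerivAt_id t).smul_const (y - x)).const_add x
      have h2 := ((hF.differentiable (by norm_num)) (x + t • (y - x))).hasFDerivAt.comp_hasDerivAt t h1
      have h3 : HasDerivAt (fun t : ℝ => t • D (y - x)) (D (y - x)) t := by
        simpa using ((hasDerivAt_id t).smul_const (D (y - x)))
      exact h2.sub h3
    have hft := intervalIntegral.integral_eq_sub_of_hasDerivAt hd
      (Continuous.intervalIntegrable (by fun_prop) _ _)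
    have e : F y - F x - D (y - x) =
        ∫ t in (0 : ℝ)..1, (fderiv ℝ F (x + t • (y - x)) - D) (y - x) := by
      rw [hft]; simp; abel
    rw [e, intervalIntegral.integral_of_le zero_le_one]
    refine (enorm_integral_le_lintegral_enorm _).trans ?_
    rw [← lintegral_const_mul _ (by fun_prop)]
    refine setLIntegral_mono (by fun_prop) fun t ht => ?_
    refine (ContinuousLinearMap.le_opENorm _ _).trans ?_
    rw [mul_comm]
    gcongr
    · rw [← ofReal_norm]; gcongr
    · apply hFN
      rw [mem_ball, dist_eq_norm, add_sub_cancel_left, norm_smul, Real.norm_of_nonneg ht.1.le]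
      nlinarith [ht.1, ht.2, norm_nonneg (y - x)]
  calc _ ≤ ∫⁻ y in ball x r, ENNReal.ofReal r * ∫⁻ t in Ioc (0 : ℝ) 1, N (x + t • (y - x)) := by
        refine setLIntegral_mono ?_ key
        refine Measurable.const_mul ?_ _
        exact Measurable.lintegral_prod_right' (f := fun p : EuclideanSpace ℝ (Fin n) × ℝ => N (x + p.2 • (p.1 - x))) (by fun_prop)
    _ = _ := by
      rw [lintegral_const_mul, lintegral_lintegral_swap (by fun_prop)]
      exact Measurable.lintegral_prod_right' (f := fun p : EuclideanSpace ℝ (Fin n) × ℝ => N (x + p.2 • (p.1 - x))) (by fun_prop)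

lemma aux_norm {n : ℕ} (L : EuclideanSpace ℝ (Fin n) →L[ℝ] EuclideanSpace ℝ (Fin n)) :
    ‖L‖ₑ ≤ ∑ i, ∑ j, ‖L (EuclideanSpace.single j 1) i‖ₑ := by
  have h : ‖L‖ ≤ ∑ i, ∑ j, ‖L (EuclideanSpace.single j 1) i‖ := by
    refine L.opNorm_le_bound (by positivity) fun w => ?_
    have hw : w = ∑ j, w j • EuclideanSpace.single j (1 : ℝ) := by
      ext i; simp [Pi.single_apply]
    have h1 : ‖L w‖ ≤ ∑ i, ‖L w i‖ := by
      have : L w = ∑ i, L w i • EuclideanSpace.single i (1 : ℝ) := by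
        ext i; simp [Pi.single_apply]
      conv_lhs => rw [this]
      refine (norm_sum_le _ _).trans (Finset.sum_le_sum fun i _ => ?_)
      rw [norm_smul]; simp
    refine h1.trans ?_
    rw [Finset.sum_mul]
    refine Finset.sum_le_sum fun i _ => ?_
    have : L w i = ∑ j, w j * L (EuclideanSpace.single j 1) i := by
      conv_lhs => rw [hw]
      simp
    rw [this, Finset.sum_mul]
    refine (norm_sum_le _ _).trans (Finset.sum_le_sum fun j _ => ?_)
    rw [norm_mul, mul_comm]
    gcongr
    exact PiLp.norm_apply_le w j
  rw [← ofReal_norm]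
  refine (ENNReal.ofReal_le_ofReal h).trans ?_
  rw [ENNReal.ofReal_sum_of_nonneg (fun _ _ => by positivity)]
  refine Finset.sum_le_sum fun i _ => ?_
  rw [ENNReal.ofReal_sum_of_nonneg (fun _ _ => by positivity)]
  exact Finset.sum_le_sum fun j _ => (ofReal_norm _).le

lemma aux_C {n : ℕ} (U : EuclideanSpace ℝ (Fin n) → EuclideanSpace ℝ (Fin n))
    (hU : LocallyIntegrable U volume)
    (G : Fin n → Fin n → EuclideanSpace ℝ (Fin n) → ℝ) (hG : ∀ i j, LocallyIntegrable (G i j) volume)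
    (S : Set (EuclideanSpace ℝ (Fin n)))
    (hw : ∀ φ : EuclideanSpace ℝ (Fin n) → ℝ, ContDiff ℝ (⊤ : ℕ∞) φ → HasCompactSupport φ →
      tsupport φ ⊆ S → ∀ i j : Fin n,
      ∫ x, U x i * fderiv ℝ φ x (EuclideanSpace.single j 1) = - ∫ x, G i j x * φ x)
    (ρ : EuclideanSpace ℝ (Fin n) → ℝ) (hρ : ContDiff ℝ (⊤ : ℕ∞) ρ) (hρc : HasCompactSupport ρ)
    (hρ0 : ∀ v, 0 ≤ ρ v) (hρ1 : ∫ v, ρ v = 1) {ε : ℝ} (hρs : tsupport ρ ⊆ closedBall 0 ε)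
    (z : EuclideanSpace ℝ (Fin n)) (hz : closedBall z ε ⊆ S)
    (a : Matrix (Fin n) (Fin n) ℝ) :
    ‖fderiv ℝ (convolution ρ U (ContinuousLinearMap.lsmul ℝ ℝ) volume) z
      - Matrix.toEuclideanCLM (𝕜 := ℝ) a‖ₑ ≤
      ∫⁻ v, ENNReal.ofReal (ρ v) * ∑ i, ∑ j, ‖G i j (z - v) - a i j‖ₑ := by
  have hρ' : ContDiff ℝ 1 ρ := hρ.of_le (by exact_mod_cast le_top)
  have hcomp : ∀ i j, (fderiv ℝ (convolution ρ U (ContinuousLinearMap.lsmul ℝ ℝ) volume) z)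
      (EuclideanSpace.single j 1) i = ∫ v, ρ v * G i j (z - v) := by
    intro i j
    rw [(hρc.hasFDerivAt_convolution_left (ContinuousLinearMap.lsmul ℝ ℝ) hρ' hU z).fderiv]
    have hex : Integrable (fun t => ((ContinuousLinearMap.lsmul ℝ ℝ (E := EuclideanSpace ℝ (Fin n))).precompL (EuclideanSpace ℝ (Fin n)))
       (fderiv ℝ ρ t) (U (z - t))) volume :=
      (hρc.fderiv (𝕜 := ℝ)).convolutionExists_left _ (hρ'.continuous_fderiv (by norm_num)) hU z
    let T : (EuclideanSpace ℝ (Fin n) →L[ℝ] EuclideanSpace ℝ (Fin n)) →L[ℝ] ℝ :=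
      (EuclideanSpace.proj i).comp (ContinuousLinearMap.apply ℝ _ (EuclideanSpace.single j (1 : ℝ)))
    have hT := T.integral_comp_comm hex
    have e1 : ((convolution (fderiv ℝ ρ) U ((ContinuousLinearMap.lsmul ℝ ℝ).precompL (EuclideanSpace ℝ (Fin n))) volume) z)
      (EuclideanSpace.single j 1) i = ∫ t, fderiv ℝ ρ t (EuclideanSpace.single j 1) * U (z - t) i := by
      change T _ = _
      refine hT.symm.trans ?_
      simp [T, ContinuousLinearMap.precompL_apply]
    rw [e1]
    set ψ : EuclideanSpace ℝ (Fin n) → ℝ := fun t => ρ (z - t) with hψ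
    have hψs : tsupport ψ ⊆ closedBall z ε := by
      refine closure_minimal (fun t ht => ?_) isClosed_closedBall
      have := hρs (subset_closure (show z - t ∈ Function.support ρ from ht))
      rw [mem_closedBall, dist_zero_right] at this
      rwa [mem_closedBall, dist_comm, dist_eq_norm]
    have hfd : ∀ t w, fderiv ℝ ψ t w = - fderiv ℝ ρ (z - t) w := by
      intro t w
      have h1 : HasFDerivAt (fun t => z - t) (-(ContinuousLinearMap.id ℝ (EuclideanSpace ℝ (Fin n)))) t :=
        (hasFDerivAt_id t).const_sub z
      have h2 := ((hρ'.differentiable (by norm_num)) (z - t)).hasFDerivAt.comp t h1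
      have : fderiv ℝ ψ t = _ := h2.fderiv
      rw [this]; simp
    have h := hw ψ (hρ.comp (by fun_prop)) (HasCompactSupport.of_support_subset_isCompact (isCompact_closedBall z ε)
      (subset_closure.trans hψs)) (hψs.trans hz) i j
    rw [← integral_sub_left_eq_self _ volume z]
    simp only [sub_sub_cancel]
    rw [← integral_sub_left_eq_self (fun v => ρ v * G i j (z - v)) volume z]
    simp only [sub_sub_cancel]
    simp only [hfd, mul_neg, integral_neg, neg_inj] at h
    rw [hψ] at h
    simpa only [mul_comm] using h
  have hb : ∀ i j, ‖(fderiv ℝ (convolution ρ U (ContinuousLinearMap.lsmul ℝ ℝ) volume) z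
      - Matrix.toEuclideanCLM (𝕜 := ℝ) a) (EuclideanSpace.single j 1) i‖ₑ
      ≤ ∫⁻ v, ENNReal.ofReal (ρ v) * ‖G i j (z - v) - a i j‖ₑ := by
    intro i j
    have hint : Integrable (fun v => ρ v * G i j (z - v)) volume :=
      hρc.convolutionExists_left (ContinuousLinearMap.lsmul ℝ ℝ) hρ.continuous (hG i j) z
    have hint2 : Integrable (fun v => ρ v * a i j) volume :=
      (hρ.continuous.integrable_of_hasCompactSupport hρc).mul_const _
    have : (fderiv ℝ (convolution ρ U (ContinuousLinearMap.lsmul ℝ ℝ) volume) z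
      - Matrix.toEuclideanCLM (𝕜 := ℝ) a) (EuclideanSpace.single j 1) i
      = ∫ v, ρ v * (G i j (z - v) - a i j) := by
      have e : (Matrix.toEuclideanCLM (𝕜 := ℝ) a) (EuclideanSpace.single j 1) i = a i j := by
        rw [Matrix.ofLp_toEuclideanCLM]; simp
      simp only [mul_sub]
      rw [integral_sub hint hint2, integral_mul_const, hρ1, one_mul, ← hcomp]
      simp only [_root_.sub_apply, PiLp.sub_apply, e]
    rw [this]
    refine (enorm_integral_le_lintegral_enorm _).trans (le_of_eq ?_)
    congr 1; ext v
    rw [enorm_mul, Real.enorm_of_nonneg (hρ0 v)]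
  refine (aux_norm _).trans ?_
  simp only [Finset.mul_sum]
  have hm : ∀ i j, AEMeasurable (fun v => ENNReal.ofReal (ρ v) * ‖G i j (z - v) - a i j‖ₑ) volume := by
    intro i j
    have h1 : AEMeasurable (fun v => G i j (z - v)) volume :=
      (hG i j).aestronglyMeasurable.aemeasurable.comp_quasiMeasurePreserving
        (quasiMeasurePreserving_sub_left volume z)
    have h2 := hρ.continuous.measurable
    have h3 : AEMeasurable (fun v => ‖G i j (z - v) - a i j‖ₑ) volume := (h1.sub_const _).enorm
    exact (ENNReal.measurable_ofReal.comp h2).aemeasurable.mul h3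
  rw [lintegral_finsetSum' _ (fun i _ => Finset.aemeasurable_fun_sum _ fun j _ => hm i j)]
  refine Finset.sum_le_sum fun i _ => ?_
  rw [lintegral_finsetSum' _ (fun j _ => hm i j)]
  exact Finset.sum_le_sum fun j _ => hb i j

lemma aux_D {n : ℕ} (U : EuclideanSpace ℝ (Fin n) → EuclideanSpace ℝ (Fin n))
    (hU : LocallyIntegrable U volume)
    (G : Fin n → Fin n → EuclideanSpace ℝ (Fin n) → ℝ) (hG : ∀ i j, LocallyIntegrable (G i j) volume)
    (hGm : ∀ i j, Measurable (G i j))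
    (S : Set (EuclideanSpace ℝ (Fin n))) (hS : IsOpen S)
    (hw : ∀ φ : EuclideanSpace ℝ (Fin n) → ℝ, ContDiff ℝ (⊤ : ℕ∞) φ → HasCompactSupport φ →
      tsupport φ ⊆ S → ∀ i j : Fin n,
      ∫ x, U x i * fderiv ℝ φ x (EuclideanSpace.single j 1) = - ∫ x, G i j x * φ x) :
    ∀ᵐ x, x ∈ S → ∀ δ : ℝ≥0∞, 0 < δ → ∀ᶠ r in 𝓝[>] (0 : ℝ),
      ∫⁻ y in ball x r, ‖U y - U x - Matrix.toEuclideanCLM (𝕜 := ℝ) (fun i j => G i j x) (y - x)‖ₑ ≤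
        ENNReal.ofReal r * (ENNReal.ofReal (2 ^ n) * ENNReal.ofReal (2 ^ n) * δ * volume (ball x r)) := by
  let φ : ℕ → ContDiffBump (0 : EuclideanSpace ℝ (Fin n)) := fun m =>
    { rIn := 1 / ((m : ℝ) + 1)
      rOut := 2 * (1 / ((m : ℝ) + 1))
      rIn_pos := by positivity
      rIn_lt_rOut := by
        have : 0 < 1 / ((m : ℝ) + 1) := by positivity
        linarith }
  have hφlim : Tendsto (fun m => (φ m).rOut) atTop (𝓝 0) := by
    have := (tendsto_one_div_add_atTop_nhds_zero_nat (𝕜 := ℝ)).const_mul 2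
    simpa [φ] using this
  have hconv := ContDiffBump.ae_convolution_tendsto_right_of_locallyIntegrable (μ := volume) (φ := φ)
    (K := 2) hφlim (Eventually.of_forall fun m => le_rfl) hU
  have hleb : ∀ᵐ x ∂(volume : Measure (EuclideanSpace ℝ (Fin n))), ∀ i j, _ :=
    ae_all_iff.2 fun i => ae_all_iff.2 fun j =>
    (Besicovitch.vitaliFamily volume).ae_tendsto_lintegral_enorm_sub_div (hG i j)
  filter_upwards [hconv, hleb] with x hx hlx hxS δ hδ
  set K : EuclideanSpace ℝ (Fin n) → ℝ≥0∞ := fun y => ∑ i, ∑ j, ‖G i j y - G i j x‖ₑ with hK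
  have hKm : Measurable K := by fun_prop
  have hsum : Tendsto (fun σ : ℝ => ∑ i, ∑ j, (∫⁻ y in closedBall x σ, ‖G i j y - G i j x‖ₑ) / volume (closedBall x σ))
      (𝓝[>] 0) (𝓝 0) := by
    have : Tendsto (fun σ : ℝ => ∑ i, ∑ j, (∫⁻ y in closedBall x σ, ‖G i j y - G i j x‖ₑ) / volume (closedBall x σ))
      (𝓝[>] 0) (𝓝 (∑ _i : Fin n, ∑ _j : Fin n, 0)) :=
      tendsto_finsetSum _ fun i _ => tendsto_finsetSum _ fun j _ =>
        (hlx i j).comp (Besicovitch.tendsto_filterAt volume x)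
    simpa using this
  have hev := hsum.eventually (eventually_lt_nhds hδ)
  obtain ⟨s₀, hs₀, hs⟩ := (mem_nhdsGT_iff_exists_Ioc_subset).1 hev
  have hs₀ : 0 < s₀ := hs₀
  have hL : ∀ σ, 0 < σ → σ ≤ s₀ → ∫⁻ y in closedBall x σ, K y ≤ δ * volume (closedBall x σ) := by
    intro σ h1 h2
    have h3 : _ < δ := hs ⟨h1, h2⟩
    have h4 : ∫⁻ y in closedBall x σ, K y = ∑ i, ∑ j, ∫⁻ y in closedBall x σ, ‖G i j y - G i j x‖ₑ := by
      rw [hK, lintegral_finsetSum _ (fun i _ => by fun_prop)]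
      refine Finset.sum_congr rfl fun i _ => ?_
      rw [lintegral_finsetSum _ (fun j _ => by fun_prop)]
    rw [h4]
    have hv0 : volume (closedBall x σ) ≠ 0 := (measure_closedBall_pos _ _ h1).ne'
    have hvt : volume (closedBall x σ) ≠ ∞ := measure_closedBall_lt_top.ne
    rw [← ENNReal.div_le_iff hv0 hvt]
    simp only [div_eq_mul_inv, Finset.sum_mul] at h3 ⊢
    exact h3.le
  obtain ⟨R, hR, hRS⟩ := Metric.nhds_basis_closedBall.mem_iff.1 (hS.mem_nhds hxS)
  have hR : 0 < R := hR
  set q := min (s₀ / 2) (R / 2) with hq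
  have hq0 : 0 < q := by positivity
  have hq1 : q ≤ s₀ / 2 := min_le_left _ _
  have hq2 : q ≤ R / 2 := min_le_right _ _
  filter_upwards [Ioc_mem_nhdsGT hq0] with r hr
  set A := Matrix.toEuclideanCLM (𝕜 := ℝ) (fun i j => G i j x) with hA
  set F : ℕ → EuclideanSpace ℝ (Fin n) → EuclideanSpace ℝ (Fin n) := fun m =>
    convolution ((φ m).normed volume) U (ContinuousLinearMap.lsmul ℝ ℝ) volume with hF
  have hFc : ∀ m, ContDiff ℝ 1 (F m) := fun m =>
    (φ m).hasCompactSupport_normed.contDiff_convolution_left _ (φ m).contDiff_normed hU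
  set B := ENNReal.ofReal r * (ENNReal.ofReal (2 ^ n) * ENNReal.ofReal (2 ^ n) * δ * volume (ball x r))
  have hbound : ∀ᶠ m in atTop, ∫⁻ y in ball x r, ‖F m y - F m x - A (y - x)‖ₑ ≤ B := by
    filter_upwards [hφlim.eventually (eventually_le_nhds hq0)] with m hm
    set ε := (φ m).rOut with hε
    have hε0 : 0 < ε := (φ m).rOut_pos
    set ρ := (φ m).normed volume with hρ
    have hρcont : Continuous ρ := (φ m).continuous_normed
    have hρm : Measurable (fun v => ENNReal.ofReal (ρ v)) := by fun_prop
    set N : EuclideanSpace ℝ (Fin n) → ℝ≥0∞ := fun z => ∫⁻ v, ENNReal.ofReal (ρ v) * K (z - v) with hN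
    have hNm : Measurable N :=
      Measurable.lintegral_prod_right' (f := fun p : EuclideanSpace ℝ (Fin n) × EuclideanSpace ℝ (Fin n) =>
        ENNReal.ofReal (ρ p.2) * K (p.1 - p.2)) (by fun_prop)
    refine (aux_A (F m) (hFc m) A N hNm x fun z hz => ?_).trans ?_
    · refine aux_C U hU G hG S hw ρ (φ m).contDiff_normed (φ m).hasCompactSupport_normed
        (fun v => (φ m).nonneg_normed v) (φ m).integral_normed (ε := ε) ?_ z ?_ _
      · rw [hρ, (φ m).tsupport_normed_eq]
      · refine (closedBall_subset_closedBall' ?_).trans hRS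
        rw [mem_ball] at hz
        linarith [hr.2]
    · refine mul_le_mul_right ?_ _
      have : ∀ t ∈ Ioc (0 : ℝ) 1, ∫⁻ y in ball x r, N (x + t • (y - x)) ≤
          ENNReal.ofReal (2 ^ n) * ENNReal.ofReal (2 ^ n) * δ * volume (ball x r) := by
        intro t ht
        have hvt : volume (closedBall (0 : EuclideanSpace ℝ (Fin n)) ε) ≠ ∞ := measure_closedBall_lt_top.ne
        have hv0 : volume (closedBall (0 : EuclideanSpace ℝ (Fin n)) ε) ≠ 0 := (measure_closedBall_pos _ _ hε0).ne'
        have hvr : 0 < volume.real (closedBall (0 : EuclideanSpace ℝ (Fin n)) ε) :=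
          ENNReal.toReal_pos hv0 hvt
        refine aux_B K (fun v => ENNReal.ofReal (ρ v)) hKm hρm x hε0 hr.1 ht.1 ht.2 (s₀ := s₀)
          (by linarith) (by linarith [hr.2]) (M := ENNReal.ofReal (2 ^ n / volume.real (closedBall (0 : EuclideanSpace ℝ (Fin n)) ε)))
          ?_ ?_ ?_ ?_ ?_ hL
        · rw [← ofReal_integral_eq_lintegral_ofReal (φ m).integrable_normed
            (Eventually.of_forall fun v => (φ m).nonneg_normed v), (φ m).integral_normed]
          simp
        · intro v hv
          have : v ∉ Function.support ρ := by
            rw [hρ, (φ m).support_normed_eq, mem_ball, dist_zero_right]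
            exact not_lt.2 hv.le
          rw [Function.notMem_support] at this
          simp [this]
        · intro v
          refine ENNReal.ofReal_le_ofReal ?_
          have := (φ m).normed_le_div_measure_closedBall_rOut volume 2 le_rfl v
          simpa using this
        · rw [← ENNReal.ofReal_one]
          exact ENNReal.ofReal_le_ofReal (one_le_pow₀ (by norm_num))
        · rw [← ENNReal.ofReal_toReal hvt, ← ENNReal.ofReal_mul (by positivity)]
          refine ENNReal.ofReal_le_ofReal (le_of_eq ?_)
          exact div_mul_cancel₀ _ hvr.ne'
      refine (setLIntegral_mono measurable_const this).trans ?_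
      simp
  have hfatou : ∫⁻ y in ball x r, ‖U y - U x - A (y - x)‖ₑ ≤
      ∫⁻ y in ball x r, liminf (fun m => ‖F m y - F m x - A (y - x)‖ₑ) atTop := by
    refine lintegral_mono_ae (ae_restrict_of_ae ?_)
    filter_upwards [hconv] with y hy
    have : Tendsto (fun m => ‖F m y - F m x - A (y - x)‖ₑ) atTop (𝓝 ‖U y - U x - A (y - x)‖ₑ) :=
      ((hy.sub hx).sub_const _).enorm
    rw [this.liminf_eq]
  refine hfatou.trans ((lintegral_liminf_le fun m => ?_).trans ?_)
  · have := (hFc m).continuous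
    exact Continuous.measurable (by fun_prop)
  · exact (liminf_le_liminf hbound).trans (by simp)

lemma aux_local
    (n : ℕ) (Ω : Set (EuclideanSpace ℝ (Fin n))) (hΩopen : IsOpen Ω)
    (f : EuclideanSpace ℝ (Fin n) → EuclideanSpace ℝ (Fin n))
    (Df : EuclideanSpace ℝ (Fin n) → Matrix (Fin n) (Fin n) ℝ)
    (hfi : LocallyIntegrableOn f Ω volume)
    (hDi : ∀ i j : Fin n, LocallyIntegrableOn (fun x => Df x i j) Ω volume)
    (hweak : IsWeakDerivOn n Ω f Df)
    (x₀ : EuclideanSpace ℝ (Fin n)) (R : ℝ) (hRΩ : closedBall x₀ R ⊆ Ω) :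
    ∀ᵐ x, x ∈ ball x₀ R →
      Tendsto (fun r : ℝ =>
          ⨍ y in Metric.ball x r ∩ Ω,
            ‖f y - f x - (EuclideanSpace.equiv (Fin n) ℝ).symm
                ((Df x).mulVec (fun j => y j - x j))‖ / r)
        (𝓝[>] (0 : ℝ)) (𝓝 0) := by
  set S := ball x₀ R with hS
  have hSo : IsOpen S := isOpen_ball
  have hSΩ : S ⊆ Ω := ball_subset_closedBall.trans hRΩ
  have hfS : IntegrableOn f S volume :=
    (hfi.integrableOn_compact_subset hRΩ (isCompact_closedBall x₀ R)).mono_set ball_subset_closedBall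
  have hDS : ∀ i j, IntegrableOn (fun x => Df x i j) S volume := fun i j =>
    ((hDi i j).integrableOn_compact_subset hRΩ (isCompact_closedBall x₀ R)).mono_set ball_subset_closedBall
  have hUi : Integrable (S.indicator f) volume := (integrable_indicator_iff hSo.measurableSet).2 hfS
  have hGi : ∀ i j, Integrable (S.indicator (fun x => Df x i j)) volume := fun i j =>
    (integrable_indicator_iff hSo.measurableSet).2 (hDS i j)
  set G : Fin n → Fin n → EuclideanSpace ℝ (Fin n) → ℝ := fun i j => (hGi i j).1.mk _ with hG
  have hGe : ∀ i j, S.indicator (fun x => Df x i j) =ᵐ[volume] G i j := fun i j =>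
    (hGi i j).1.ae_eq_mk
  have hD := aux_D (S.indicator f) hUi.locallyIntegrable G
    (fun i j => ((hGi i j).congr (hGe i j)).locallyIntegrable)
    (fun i j => (hGi i j).1.stronglyMeasurable_mk.measurable) S hSo (by
      intro φ h1 h2 h3 i j
      have h := hweak φ h1 h2 (h3.trans hSΩ) i j
      rw [← integral_indicator hΩopen.measurableSet, ← integral_indicator hΩopen.measurableSet] at h
      have e1 : ∫ x, (S.indicator f x) i * fderiv ℝ φ x (EuclideanSpace.single j 1) =
          ∫ x, Ω.indicator (fun x => f x i * fderiv ℝ φ x (EuclideanSpace.single j 1)) x := by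
        congr 1; ext x
        by_cases hx : x ∈ S
        · rw [indicator_of_mem hx, indicator_of_mem (hSΩ hx)]
        · have h0 : fderiv ℝ φ x = 0 := by
            by_contra hne
            exact hx (h3 (support_fderiv_subset ℝ hne))
          rw [indicator_of_notMem hx]
          simp [indicator, h0]
      have e2 : ∫ x, G i j x * φ x = ∫ x, Ω.indicator (fun x => Df x i j * φ x) x := by
        refine integral_congr_ae ?_
        filter_upwards [hGe i j] with x hx'
        rw [← hx']
        by_cases hx : x ∈ S
        · rw [indicator_of_mem hx, indicator_of_mem (hSΩ hx)]
        · have h0 : φ x = 0 := by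
            by_contra hne
            exact hx (h3 (subset_closure hne))
          simp [indicator, h0]
      rw [e1, e2, h])
  have hGe' : ∀ᵐ x ∂(volume : Measure (EuclideanSpace ℝ (Fin n))), ∀ i j,
      S.indicator (fun x => Df x i j) x = G i j x :=
    ae_all_iff.2 fun i => ae_all_iff.2 fun j => hGe i j
  filter_upwards [hD, hGe'] with x hx hGx hxS
  have hx := hx hxS
  have hDx : (fun i j => G i j x : Matrix (Fin n) (Fin n) ℝ) = Df x := by
    ext i j
    rw [← hGx i j, indicator_of_mem hxS]
  rw [hDx] at hx
  obtain ⟨q, hq, hqS⟩ := Metric.isOpen_iff.1 hSo x hxS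
  rw [Metric.tendsto_nhds]
  intro η hη
  set C : ℝ := 2 ^ n * 2 ^ n with hC
  have hC0 : 0 < C := by positivity
  filter_upwards [hx (ENNReal.ofReal (η / 2 / C)) (by simpa using by positivity), Ioc_mem_nhdsGT hq] with r hr hrq
  have hr0 : 0 < r := hrq.1
  have hbS : ball x r ⊆ S := (ball_subset_ball hrq.2).trans hqS
  rw [inter_eq_left.2 (hbS.trans hSΩ)]
  set g : EuclideanSpace ℝ (Fin n) → EuclideanSpace ℝ (Fin n) := fun y =>
    f y - f x - (EuclideanSpace.equiv (Fin n) ℝ).symm ((Df x).mulVec (fun j => y j - x j)) with hg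
  have hgA : ∀ y, g y = f y - f x - Matrix.toEuclideanCLM (𝕜 := ℝ) (Df x) (y - x) := fun y => rfl
  have hgm : AEStronglyMeasurable g (volume.restrict (ball x r)) := by
    have h1 : AEStronglyMeasurable f (volume.restrict (ball x r)) := (hfS.mono_set hbS).1
    have h2 : Continuous (fun y => Matrix.toEuclideanCLM (𝕜 := ℝ) (Df x) (y - x)) := by fun_prop
    have : g = fun y => f y - f x - Matrix.toEuclideanCLM (𝕜 := ℝ) (Df x) (y - x) := funext hgA
    rw [this]
    exact (h1.sub aestronglyMeasurable_const).sub h2.aestronglyMeasurable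
  have hlin : ∫⁻ y in ball x r, ‖g y‖ₑ ≤ ENNReal.ofReal (r * (η / 2)) * volume (ball x r) := by
    calc _ = ∫⁻ y in ball x r, ‖S.indicator f y - S.indicator f x - Matrix.toEuclideanCLM (𝕜 := ℝ) (Df x) (y - x)‖ₑ := by
          refine setLIntegral_congr_fun measurableSet_ball fun y hy => ?_
          simp only [indicator_of_mem (hbS hy), indicator_of_mem hxS, hgA]
      _ ≤ _ := hr
      _ = _ := by
        rw [← ENNReal.ofReal_mul (by positivity), ← ENNReal.ofReal_mul (by positivity), ← mul_assoc,
          ← ENNReal.ofReal_mul (by positivity)]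
        congr 2
        rw [← hC]; field_simp
  have hv0 : volume (ball x r) ≠ 0 := (measure_ball_pos _ _ hr0).ne'
  have hvt : volume (ball x r) ≠ ∞ := measure_ball_lt_top.ne
  have hvr : 0 < volume.real (ball x r) := ENNReal.toReal_pos hv0 hvt
  have hreal : ∫ y in ball x r, ‖g y‖ ≤ r * (η / 2) * volume.real (ball x r) := by
    rw [integral_norm_eq_lintegral_enorm hgm]
    refine (ENNReal.toReal_mono (ENNReal.mul_ne_top ENNReal.ofReal_ne_top hvt) hlin).trans (le_of_eq ?_)
    rw [ENNReal.toReal_mul, ENNReal.toReal_ofReal (by positivity)]; rfl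
  change dist (⨍ y in ball x r, ‖g y‖ / r) 0 < η
  rw [setAverage_eq, integral_div, dist_zero_right, smul_eq_mul]
  have hnn : 0 ≤ ∫ y in ball x r, ‖g y‖ := by positivity
  rw [Real.norm_of_nonneg (by positivity)]
  calc _ ≤ (volume.real (ball x r))⁻¹ * (r * (η / 2) * volume.real (ball x r) / r) := by gcongr
    _ = η / 2 := by field_simp
    _ < η := by linarith

/-- A map `f ∈ W^{1,1}_loc(Ω, ℝⁿ)` is approximately differentiable a.e. in the `L¹` sense:
for a.e. `x ∈ Ω`, with `Df x` the weak derivative at `x`,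
`⨍_{B(x,r) ∩ Ω} |f(y) − f(x) − Df(x)(y − x)| / r dy → 0` as `r → 0⁺`. -/
theorem w11loc_approx_differentiable_ae
    (n : ℕ) (Ω : Set (EuclideanSpace ℝ (Fin n))) (hΩopen : IsOpen Ω)
    (f : EuclideanSpace ℝ (Fin n) → EuclideanSpace ℝ (Fin n))
    (Df : EuclideanSpace ℝ (Fin n) → Matrix (Fin n) (Fin n) ℝ)
    (hf : MemW11loc n Ω f Df) :
    ∀ᵐ x ∂(volume.restrict Ω),
      Tendsto (fun r : ℝ =>
          ⨍ y in Metric.ball x r ∩ Ω,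
            ‖f y - f x - (EuclideanSpace.equiv (Fin n) ℝ).symm
                ((Df x).mulVec (fun j => y j - x j))‖ / r)
        (𝓝[>] (0 : ℝ)) (𝓝 0) := by
  obtain ⟨hfi, hDi, hweak⟩ := hf
  rw [ae_restrict_iff' hΩopen.measurableSet]
  have hnull : volume {x | x ∈ Ω ∧ ¬ Tendsto (fun r : ℝ =>
          ⨍ y in Metric.ball x r ∩ Ω,
            ‖f y - f x - (EuclideanSpace.equiv (Fin n) ℝ).symm
                ((Df x).mulVec (fun j => y j - x j))‖ / r)
        (𝓝[>] (0 : ℝ)) (𝓝 0)} = 0 := by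
    refine measure_null_of_locally_null _ fun x₀ hx₀ => ?_
    obtain ⟨R, hR, hRΩ⟩ := Metric.nhds_basis_closedBall.mem_iff.1 (hΩopen.mem_nhds hx₀.1)
    have hloc := aux_local n Ω hΩopen f Df hfi hDi hweak x₀ R hRΩ
    refine ⟨{x | x ∈ Ω ∧ ¬ _} ∩ ball x₀ R, inter_mem self_mem_nhdsWithin
      (mem_nhdsWithin_of_mem_nhds (ball_mem_nhds x₀ hR)), ?_⟩
    rw [ae_iff] at hloc
    refine measure_mono_null ?_ hloc
    rintro x ⟨⟨_, h1⟩, h2⟩ h3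
    exact h1 (h3 h2)
  rw [ae_iff]
  refine measure_mono_null ?_ hnull
  intro x hx
  simpa using hx
end

section
/- Let Ω ⊆ ℝⁿ be open and let f ∈ W^{1,1}_loc(Ω,ℝⁿ), with a fixed representative that is approximately differentiable almost everywhere. Then there exists a set N ⊆ Ω with Lebesgue measure |N| = 0 such that f satisfies the Lusin (N) condition on Ω \ N, i.e. for every set E ⊆ Ω \ N with |E| = 0 one has |f(E)| = 0. -/
open MeasureTheory Filter Metric Set
open scoped ENNReal Topology

/-- `f` is approximately differentiable at `x` with approximate differential (the matrix) `L`: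
for every `ε > 0` the set of points `y` near `x` where
`|f(y) − f(x) − L(y − x)| > ε|y − x|` has density `0` at `x`. -/
def HasApproxDerivAt (n : ℕ)
    (f : EuclideanSpace ℝ (Fin n) → EuclideanSpace ℝ (Fin n))
    (L : Matrix (Fin n) (Fin n) ℝ) (x : EuclideanSpace ℝ (Fin n)) : Prop :=
  ∀ ε : ℝ, 0 < ε →
    Tendsto (fun r : ℝ =>
        volume {y ∈ Metric.ball x r |
            ε * ‖y - x‖ < ‖f y - f x - (EuclideanSpace.equiv (Fin n) ℝ).symm
              (L.mulVec (fun j => y j - x j))‖} / volume (Metric.ball x r))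
      (𝓝[>] (0 : ℝ)) (𝓝 0)

/-- `f` is approximately differentiable at `x`. -/
def ApproxDifferentiableAt (n : ℕ)
    (f : EuclideanSpace ℝ (Fin n) → EuclideanSpace ℝ (Fin n))
    (x : EuclideanSpace ℝ (Fin n)) : Prop :=
  ∃ L : Matrix (Fin n) (Fin n) ℝ, HasApproxDerivAt n f L x

def goodSet (n : ℕ) (f : EuclideanSpace ℝ (Fin n) → EuclideanSpace ℝ (Fin n)) (k : ℕ) :
    Set (EuclideanSpace ℝ (Fin n)) :=
  {x | ∀ r : ℝ, 0 < r → r < 1 / ((k : ℝ) + 1) →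
    volume {y ∈ Metric.ball x r | (k : ℝ) * ‖y - x‖ < ‖f y - f x‖}
      ≤ ENNReal.ofReal (1 / (4 * 2 ^ n)) * volume (Metric.ball x r)}

lemma exists_mem_goodSet (n : ℕ) (f : EuclideanSpace ℝ (Fin n) → EuclideanSpace ℝ (Fin n))
    (x : EuclideanSpace ℝ (Fin n)) (h : ApproxDifferentiableAt n f x) :
    ∃ k, x ∈ goodSet n f k := by
  obtain ⟨L, hL⟩ := h
  have h1 := hL 1 one_pos
  have hc : (0 : ℝ≥0∞) < ENNReal.ofReal (1 / (4 * 2 ^ n)) := by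
    rw [ENNReal.ofReal_pos]; positivity
  have h2 := h1.eventually (gt_mem_nhds hc)
  rw [eventually_nhdsWithin_iff, Metric.eventually_nhds_iff] at h2
  obtain ⟨δ, hδ, h3⟩ := h2
  let T := LinearMap.toContinuousLinearMap (Matrix.toEuclideanLin L)
  obtain ⟨k, hk⟩ := exists_nat_gt (max (‖T‖ + 1) (1 / δ))
  have hk1 : ‖T‖ + 1 < k := lt_of_le_of_lt (le_max_left _ _) hk
  have hk2 : 1 / δ < k := lt_of_le_of_lt (le_max_right _ _) hk
  refine ⟨k, fun r hr hrk => ?_⟩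
  have hrδ : r < δ := by
    refine hrk.trans ?_
    rw [div_lt_iff₀ (by positivity)]
    rw [div_lt_iff₀ hδ] at hk2
    nlinarith
  have h4 := h3 (y := r) (by simpa [abs_of_pos hr] using hrδ) hr
  have hb0 : volume (Metric.ball x r) ≠ 0 := (measure_ball_pos _ _ hr).ne'
  have h5 := (ENNReal.div_le_iff hb0 measure_ball_lt_top.ne).1 h4.le
  refine le_trans (measure_mono ?_) h5
  rintro y ⟨hy, hy2⟩
  refine ⟨hy, ?_⟩
  have hT : (EuclideanSpace.equiv (Fin n) ℝ).symm (L.mulVec (fun j => y j - x j))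
      = T (y - x) := by
    rfl
  rw [hT]
  have h6 := T.le_opNorm (y - x)
  have h7 := norm_sub_norm_le (f y - f x) (T (y - x))
  nlinarith [norm_nonneg (y - x)]

lemma goodSet_lip (n : ℕ) (f : EuclideanSpace ℝ (Fin n) → EuclideanSpace ℝ (Fin n)) (k : ℕ)
    (x y : EuclideanSpace ℝ (Fin n)) (hx : x ∈ goodSet n f k) (hy : y ∈ goodSet n f k)
    (hxy : dist x y < 1 / (2 * ((k : ℝ) + 1))) : dist (f x) (f y) ≤ 3 * k * dist x y := by
  rcases eq_or_ne x y with rfl | hne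
  · simp
  set r := dist x y with hr
  have hr0 : 0 < r := dist_pos.2 hne
  have h2r : 2 * r < 1 / ((k : ℝ) + 1) := by
    rw [lt_div_iff₀ (by positivity)] at hxy ⊢
    linarith
  have hX := hx (2 * r) (by positivity) h2r
  have hY := hy (2 * r) (by positivity) h2r
  have hv : ∀ z : EuclideanSpace ℝ (Fin n), ENNReal.ofReal (1 / (4 * 2 ^ n)) *
      volume (Metric.ball z (2 * r)) = ENNReal.ofReal (1 / 4) * volume (Metric.ball x r) := by
    intro z
    rw [Measure.addHaar_ball_of_pos _ z (r := 2 * r) (by positivity), Measure.addHaar_ball_of_pos _ x hr0,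
      ← mul_assoc, ← mul_assoc, ← ENNReal.ofReal_mul (by positivity),
      ← ENNReal.ofReal_mul (by positivity)]
    congr 2
    simp only [finrank_euclideanSpace, Fintype.card_fin]
    rw [mul_pow]
    field_simp
  rw [hv] at hX hY
  have hex : ∃ z ∈ Metric.ball x r, ¬ ((k : ℝ) * ‖z - x‖ < ‖f z - f x‖) ∧
      ¬ ((k : ℝ) * ‖z - y‖ < ‖f z - f y‖) := by
    by_contra! hcon
    have hsub : Metric.ball x r ⊆
        {z ∈ Metric.ball x (2 * r) | (k : ℝ) * ‖z - x‖ < ‖f z - f x‖} ∪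
        {z ∈ Metric.ball y (2 * r) | (k : ℝ) * ‖z - y‖ < ‖f z - f y‖} := by
      intro z hz
      have hz' : dist z x < r := hz
      by_cases h : (k : ℝ) * ‖z - x‖ < ‖f z - f x‖
      · left
        exact ⟨by rw [Metric.mem_ball]; linarith, h⟩
      · right
        refine ⟨?_, hcon z hz (not_lt.1 h)⟩
        rw [Metric.mem_ball]
        have := dist_triangle z x y
        linarith
    have hle := ((measure_mono hsub).trans (measure_union_le _ _)).trans (add_le_add hX hY)
    rw [← add_mul, ← ENNReal.ofReal_add (by norm_num) (by norm_num)] at hle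
    have hb0 : volume (Metric.ball x r) ≠ 0 := (measure_ball_pos _ _ hr0).ne'
    have hlt : ENNReal.ofReal (1 / 4 + 1 / 4) * volume (Metric.ball x r)
        < 1 * volume (Metric.ball x r) := by
      refine ENNReal.mul_lt_mul_left hb0 measure_ball_lt_top.ne ?_
      rw [← ENNReal.ofReal_one]
      exact (ENNReal.ofReal_lt_ofReal_iff one_pos).2 (by norm_num)
    rw [one_mul] at hlt
    exact absurd hle (not_le.2 hlt)
  obtain ⟨z, hz, h1, h2⟩ := hex
  rw [← dist_eq_norm, ← dist_eq_norm, not_lt] at h1 h2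
  have hz' : dist z x < r := hz
  have h3 := dist_triangle z x y
  have h4 := dist_triangle_left (f x) (f y) (f z)
  have hk : (0 : ℝ) ≤ k := Nat.cast_nonneg k
  nlinarith

lemma lip_null (n : ℕ) (f : EuclideanSpace ℝ (Fin n) → EuclideanSpace ℝ (Fin n)) (K : NNReal)
    (s : Set (EuclideanSpace ℝ (Fin n))) (h : LipschitzOnWith K f s) (hs : volume s = 0) :
    volume (f '' s) = 0 := by
  have e := h.hausdorffMeasure_image_le (d := (n : ℝ)) (Nat.cast_nonneg n)
  have hH : (Measure.hausdorffMeasure (n : ℝ) : Measure (EuclideanSpace ℝ (Fin n))).IsAddHaarMeasure := by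
    have := MeasureTheory.isAddHaarMeasure_hausdorffMeasure (E := EuclideanSpace ℝ (Fin n))
    simpa using this
  have a1 : (Measure.hausdorffMeasure (n : ℝ) : Measure (EuclideanSpace ℝ (Fin n))) ≪ volume :=
    Measure.absolutelyContinuous_isAddHaarMeasure _ _
  have a2 : (volume : Measure (EuclideanSpace ℝ (Fin n))) ≪ Measure.hausdorffMeasure (n : ℝ) :=
    Measure.absolutelyContinuous_isAddHaarMeasure _ _
  rw [a1 hs, mul_zero] at e
  exact a2 (le_antisymm e zero_le)

/-- If `f ∈ W^{1,1}_loc(Ω, ℝⁿ)` (with a fixed representative that is approximately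
differentiable a.e.), then there is a null set `N ⊆ Ω` such that `f` satisfies the Lusin (N)
condition on `Ω \ N`: every null subset of `Ω \ N` is mapped onto a null set. -/
theorem lusin_condition_off_null_set
    (n : ℕ) (Ω : Set (EuclideanSpace ℝ (Fin n))) (hΩopen : IsOpen Ω)
    (f : EuclideanSpace ℝ (Fin n) → EuclideanSpace ℝ (Fin n))
    (Df : EuclideanSpace ℝ (Fin n) → Matrix (Fin n) (Fin n) ℝ)
    (hf : MemW11loc n Ω f Df)
    (happ : ∀ᵐ x ∂(volume.restrict Ω), ApproxDifferentiableAt n f x) :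
    ∃ N : Set (EuclideanSpace ℝ (Fin n)), N ⊆ Ω ∧ volume N = 0 ∧
      ∀ E : Set (EuclideanSpace ℝ (Fin n)), E ⊆ Ω \ N → volume E = 0 →
        volume (f '' E) = 0 := by
  refine ⟨{x ∈ Ω | ¬ ApproxDifferentiableAt n f x}, fun x hx => hx.1, ?_, ?_⟩
  · rw [ae_restrict_iff' hΩopen.measurableSet, ae_iff] at happ
    refine measure_mono_null ?_ happ
    rintro x ⟨h1, h2⟩
    simp [h1, h2]
  · intro E hE hE0
    obtain ⟨D, hDc, hDd⟩ := TopologicalSpace.exists_countable_dense (EuclideanSpace ℝ (Fin n))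
    have hcov : f '' E ⊆ ⋃ k : ℕ, ⋃ d ∈ D,
        f '' (E ∩ goodSet n f k ∩ Metric.ball d (1 / (4 * ((k : ℝ) + 1)))) := by
      rintro _ ⟨x, hx, rfl⟩
      have hx' : ApproxDifferentiableAt n f x := by
        by_contra hc
        exact (hE hx).2 ⟨(hE hx).1, hc⟩
      obtain ⟨k, hk⟩ := exists_mem_goodSet n f x hx'
      obtain ⟨d, hd, hdx⟩ := hDd.exists_dist_lt x
        (show (0 : ℝ) < 1 / (4 * ((k : ℝ) + 1)) by positivity)
      simp only [mem_iUnion]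
      exact ⟨k, d, hd, x, ⟨⟨hx, hk⟩, hdx⟩, rfl⟩
    refine measure_mono_null hcov ?_
    rw [measure_iUnion_null_iff]
    intro k
    rw [measure_biUnion_null_iff hDc]
    intro d _
    refine lip_null n f (3 * k) _ ?_ (measure_mono_null (fun x hx => hx.1.1) hE0)
    refine LipschitzOnWith.of_dist_le_mul fun x hx y hy => ?_
    have := goodSet_lip n f k x y hx.1.2 hy.1.2 (by
      have h1 : dist x d < _ := hx.2
      have h2 : dist y d < _ := hy.2
      have h3 := dist_triangle_right x y d
      have h4 : 1 / (2 * ((k : ℝ) + 1)) = 1 / (4 * ((k : ℝ) + 1)) + 1 / (4 * ((k : ℝ) + 1)) := by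
        field_simp; norm_num
      linarith)
    simpa using this
end

section
/- Let Ω ⊆ ℝⁿ be open and let f ∈ W^{1,1}_loc(Ω,ℝⁿ), with a fixed representative that is approximately differentiable almost everywhere, and assume the Jacobian J_f = det Df > 0 almost everywhere in Ω. Then for every Lebesgue measurable set E ⊆ Ω with |E| > 0, the image f(E) has positive Lebesgue outer measure. -/
open MeasureTheory Filter Metric Set
open scoped ENNReal Topology

/-- Bad set. -/
def badSet (n : ℕ) (f : EuclideanSpace ℝ (Fin n) → EuclideanSpace ℝ (Fin n))
    (L : Matrix (Fin n) (Fin n) ℝ) (ε : ℝ) (x : EuclideanSpace ℝ (Fin n)) (r : ℝ) :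
    Set (EuclideanSpace ℝ (Fin n)) :=
  {y ∈ Metric.ball x r | ε * ‖y - x‖ < ‖f y - f x - (EuclideanSpace.equiv (Fin n) ℝ).symm
              (L.mulVec (fun j => y j - x j))‖}

lemma not_bad (n : ℕ) (f : EuclideanSpace ℝ (Fin n) → EuclideanSpace ℝ (Fin n))
    (L : Matrix (Fin n) (Fin n) ℝ) (ε : ℝ) (x y : EuclideanSpace ℝ (Fin n)) (r : ℝ)
    (hy : y ∈ Metric.ball x r) (h : y ∉ badSet n f L ε x r) :
    ‖f y - f x - Matrix.toEuclideanCLM (n := Fin n) (𝕜 := ℝ) L (y - x)‖ ≤ ε * ‖y - x‖ := by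
  by_contra hc
  push Not at hc
  exact h ⟨hy, hc⟩

lemma toCLM_det_ne (n : ℕ) (L : Matrix (Fin n) (Fin n) ℝ) (h : L.det ≠ 0) :
    (Matrix.toEuclideanCLM (n := Fin n) (𝕜 := ℝ) L).det ≠ 0 := by
  have h1 : IsUnit L := (Matrix.isUnit_iff_isUnit_det L).2 (isUnit_iff_ne_zero.2 h)
  obtain ⟨M, hM⟩ := h1.exists_right_inv
  intro h0
  have h2 : Matrix.toEuclideanCLM (n := Fin n) (𝕜 := ℝ) L *
      Matrix.toEuclideanCLM (n := Fin n) (𝕜 := ℝ) M = 1 := by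
    rw [← map_mul, hM, map_one]
  have h3 := congrArg (fun T : EuclideanSpace ℝ (Fin n) →L[ℝ] EuclideanSpace ℝ (Fin n) =>
    LinearMap.det (T : EuclideanSpace ℝ (Fin n) →ₗ[ℝ] EuclideanSpace ℝ (Fin n))) h2
  simp only [ContinuousLinearMap.toLinearMap_mul, map_mul, ContinuousLinearMap.toLinearMap_one,
    map_one] at h3
  rw [ContinuousLinearMap.det] at h0
  rw [h0] at h3
  simp at h3

/-- Density constant. -/
noncomputable def dc (n : ℕ) : ℝ≥0∞ := ENNReal.ofReal ((1/2)^n/3)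

lemma exists_good (n : ℕ) (x z : EuclideanSpace ℝ (Fin n)) (r : ℝ) (hr : 0 < r)
    (A B : Set (EuclideanSpace ℝ (Fin n)))
    (hA : volume A ≤ dc n * volume (ball x (2 * r)))
    (hB : volume B ≤ dc n * volume (ball z (2 * r))) :
    ∃ y ∈ ball x r, y ∉ A ∧ y ∉ B := by
  by_contra hc
  push Not at hc
  have hsub : ball x r ⊆ A ∪ B := fun y hy => by
    by_cases h : y ∈ A
    · exact Or.inl h
    · exact Or.inr (hc y hy h)
  have h1 : volume (ball x r) ≤ dc n * volume (ball x (2 * r)) + dc n * volume (ball z (2 * r)) :=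
    (measure_mono hsub).trans ((measure_union_le _ _).trans (add_le_add hA hB))
  rw [Measure.addHaar_ball_of_pos _ x hr, Measure.addHaar_ball_of_pos _ x (by positivity : 0 < 2 * r),
    Measure.addHaar_ball_of_pos _ z (by positivity : 0 < 2 * r), finrank_euclideanSpace_fin,
    ← mul_assoc, ← add_mul] at h1
  have hV0 : volume (ball (0 : EuclideanSpace ℝ (Fin n)) 1) ≠ 0 :=
    (measure_ball_pos _ _ one_pos).ne'
  have hV1 : volume (ball (0 : EuclideanSpace ℝ (Fin n)) 1) ≠ ∞ := measure_ball_lt_top.ne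
  rw [ENNReal.mul_le_mul_iff_left hV0 hV1, dc, ← ENNReal.ofReal_mul (by positivity),
    ← ENNReal.ofReal_add (by positivity) (by positivity),
    ENNReal.ofReal_le_ofReal_iff (by positivity)] at h1
  have h2 : (1/2 : ℝ)^n/3 * (2*r)^n = r^n/3 := by
    rw [div_mul_eq_mul_div, ← mul_pow]; congr 2; ring
  rw [h2] at h1
  have : 0 < r^n := by positivity
  linarith

lemma approx_on_piece (n : ℕ) (f : EuclideanSpace ℝ (Fin n) → EuclideanSpace ℝ (Fin n))
    (Df : EuclideanSpace ℝ (Fin n) → Matrix (Fin n) (Fin n) ℝ)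
    (A : EuclideanSpace ℝ (Fin n) →L[ℝ] EuclideanSpace ℝ (Fin n)) (δ : NNReal) (ρ : ℝ)
    (S : Set (EuclideanSpace ℝ (Fin n)))
    (h1 : ∀ x ∈ S, ‖Matrix.toEuclideanCLM (n := Fin n) (𝕜 := ℝ) (Df x) - A‖ ≤ δ / 6)
    (h2 : ∀ x ∈ S, ∀ r, 0 < r → r < ρ →
      volume (badSet n f (Df x) (δ / 6) x r) ≤ dc n * volume (ball x r))
    (h3 : ∀ x ∈ S, ∀ z ∈ S, 2 * ‖x - z‖ < ρ) :
    ApproximatesLinearOn f A S δ := by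
  intro x hx z hz
  rcases eq_or_ne x z with rfl | hne
  · simp
  have hr : 0 < ‖x - z‖ := norm_pos_iff.2 (sub_ne_zero.2 hne)
  set r := ‖x - z‖ with hrdef
  obtain ⟨y, hy, hyx, hyz⟩ := exists_good n x z r hr _ _
    (h2 x hx (2 * r) (by positivity) (h3 x hx z hz)) (h2 z hz (2 * r) (by positivity) (h3 x hx z hz))
  have hyx' : ‖y - x‖ < r := by simpa [dist_eq_norm] using hy
  have hyz' : ‖y - z‖ < 2 * r := by
    calc ‖y - z‖ = ‖(y - x) + (x - z)‖ := by congr 1; abel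
      _ ≤ ‖y - x‖ + ‖x - z‖ := norm_add_le _ _
      _ < 2 * r := by linarith
  have key : ∀ w ∈ S, y ∈ ball w (2 * r) → y ∉ badSet n f (Df w) (δ / 6) w (2 * r) →
      ‖f y - f w - A (y - w)‖ ≤ δ / 3 * ‖y - w‖ := by
    intro w hw hb hn
    have e1 := not_bad n f _ _ w y _ hb hn
    set T := Matrix.toEuclideanCLM (n := Fin n) (𝕜 := ℝ) (Df w) with hT
    have e2 : ‖(T - A) (y - w)‖ ≤ δ / 6 * ‖y - w‖ :=
      ((T - A).le_opNorm _).trans (mul_le_mul_of_nonneg_right (h1 w hw) (norm_nonneg _))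
    calc ‖f y - f w - A (y - w)‖ = ‖(f y - f w - T (y - w)) + (T - A) (y - w)‖ := by
          congr 1; rw [ContinuousLinearMap.sub_apply]; abel
      _ ≤ _ := norm_add_le _ _
      _ ≤ δ / 6 * ‖y - w‖ + δ / 6 * ‖y - w‖ := add_le_add e1 e2
      _ = _ := by ring
  have kx := key x hx (by rw [mem_ball, dist_eq_norm]; linarith) hyx
  have kz := key z hz (by rw [mem_ball, dist_eq_norm]; linarith) hyz
  have hδ : (0 : ℝ) ≤ δ := δ.2
  calc ‖f x - f z - A (x - z)‖ = ‖(f y - f z - A (y - z)) - (f y - f x - A (y - x))‖ := by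
        congr 1; simp only [map_sub]; abel
    _ ≤ ‖f y - f z - A (y - z)‖ + ‖f y - f x - A (y - x)‖ := norm_sub_le _ _
    _ ≤ δ / 3 * ‖y - z‖ + δ / 3 * ‖y - x‖ := add_le_add kz kx
    _ ≤ δ / 3 * (2 * r) + δ / 3 * r := by gcongr
    _ = δ * r := by ring

lemma exists_delta (n : ℕ) (A : EuclideanSpace ℝ (Fin n) →L[ℝ] EuclideanSpace ℝ (Fin n))
    (hA : A.det ≠ 0) : ∃ δ : NNReal, 0 < δ ∧
      ∀ (s : Set (EuclideanSpace ℝ (Fin n))) (f : EuclideanSpace ℝ (Fin n) → EuclideanSpace ℝ (Fin n)),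
        ApproximatesLinearOn f A s δ → volume (f '' s) = 0 → volume s = 0 := by
  have hpos : 0 < ENNReal.ofReal |A.det| := ENNReal.ofReal_pos.2 (abs_pos.2 hA)
  obtain ⟨m, hm0, hm⟩ := ENNReal.lt_iff_exists_nnreal_btwn.1 hpos
  obtain ⟨δ, hδ, hδ0⟩ := ((mul_le_addHaar_image_of_lt_det volume A hm).and
    self_mem_nhdsWithin).exists
  refine ⟨δ, hδ0, fun s f hs h0 => ?_⟩
  have := hδ s f hs
  rw [h0, nonpos_iff_eq_zero, mul_eq_zero] at this
  exact this.resolve_left hm0.ne'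

/-- If `f ∈ W^{1,1}_loc(Ω, ℝⁿ)` (with a fixed representative that is approximately
differentiable a.e., with approximate differential `Df`) and `J_f = det Df > 0` a.e. in `Ω`,
then the image of every measurable subset of `Ω` of positive measure has positive Lebesgue
outer measure. -/
theorem image_of_positive_measure_set_has_positive_measure
    (n : ℕ) (Ω : Set (EuclideanSpace ℝ (Fin n))) (hΩopen : IsOpen Ω)
    (f : EuclideanSpace ℝ (Fin n) → EuclideanSpace ℝ (Fin n))
    (Df : EuclideanSpace ℝ (Fin n) → Matrix (Fin n) (Fin n) ℝ)
    (hf : MemW11loc n Ω f Df)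
    (happ : ∀ᵐ x ∂(volume.restrict Ω), HasApproxDerivAt n f (Df x) x)
    (hJ : ∀ᵐ x ∂(volume.restrict Ω), 0 < (Df x).det) :
    ∀ E : Set (EuclideanSpace ℝ (Fin n)), E ⊆ Ω → NullMeasurableSet E volume →
      0 < volume E → 0 < volume (f '' E) := by
  intro E hE _ hpos
  rw [pos_iff_ne_zero] at hpos ⊢
  intro h0
  apply hpos
  rw [ae_restrict_iff' hΩopen.measurableSet] at happ hJ
  choose! δ hδ0 hδ using exists_delta n
  have hcov : ∀ A ∈ {A : EuclideanSpace ℝ (Fin n) →L[ℝ] EuclideanSpace ℝ (Fin n) | A.det ≠ 0},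
      ball A (δ A / 6) ∈
        𝓝[{A : EuclideanSpace ℝ (Fin n) →L[ℝ] EuclideanSpace ℝ (Fin n) | A.det ≠ 0}] A := by
    intro A hA
    have : (0 : ℝ) < δ A := hδ0 A hA
    exact mem_nhdsWithin_of_mem_nhds (ball_mem_nhds _ (by positivity))
  obtain ⟨t, hts, htc, htcov⟩ := TopologicalSpace.countable_cover_nhdsWithin hcov
  let S : (EuclideanSpace ℝ (Fin n) →L[ℝ] EuclideanSpace ℝ (Fin n)) → ℕ →
      Set (EuclideanSpace ℝ (Fin n)) := fun A m =>
    {x ∈ E | ‖Matrix.toEuclideanCLM (n := Fin n) (𝕜 := ℝ) (Df x) - A‖ ≤ δ A / 6 ∧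
      ∀ r, 0 < r → r < 1 / ((m : ℝ) + 1) →
        volume (badSet n f (Df x) (δ A / 6) x r) ≤ dc n * volume (ball x r)}
  have hS : ∀ A ∈ t, ∀ m, volume (S A m) = 0 := by
    intro A hA m
    refine measure_null_of_locally_null _ fun x _ => ?_
    have hρ : (0 : ℝ) < 1 / ((m : ℝ) + 1) := by positivity
    refine ⟨S A m ∩ ball x (1 / ((m : ℝ) + 1) / 4),
      inter_mem_nhdsWithin _ (ball_mem_nhds _ (by positivity)), ?_⟩
    refine hδ A (hts hA) _ f (approx_on_piece n f Df A (δ A) (1 / ((m : ℝ) + 1)) _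
      (fun y hy => hy.1.2.1) (fun y hy => hy.1.2.2) ?_) ?_
    · intro y hy z hz
      have h1 := hy.2
      have h2 := hz.2
      rw [mem_ball] at h1 h2
      have := dist_triangle_right y z x
      rw [dist_eq_norm y z] at this
      linarith
    · exact measure_mono_null (image_mono fun y hy => hy.1.1) h0
  have hU : volume (⋃ A ∈ t, ⋃ m, S A m) = 0 :=
    (measure_biUnion_null_iff htc).2 fun A hA => measure_iUnion_null (hS A hA)
  refine measure_mono_null_ae ?_ hU
  filter_upwards [happ, hJ] with x hx1 hx2 hxE
  have hdet := toCLM_det_ne n _ (hx2 (hE hxE)).ne'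
  obtain ⟨A, hAt, hxA⟩ := mem_iUnion₂.1 (htcov hdet)
  have hδA : (0 : ℝ) < δ A := hδ0 A (hts hAt)
  have hdc : 0 < dc n := ENNReal.ofReal_pos.2 (by positivity)
  have hev := (hx1 (hE hxE) (δ A / 6) (by positivity)).eventually (gt_mem_nhds hdc)
  obtain ⟨u, hu0, hu⟩ := mem_nhdsGT_iff_exists_Ioo_subset.1 hev
  obtain ⟨m, hm⟩ := exists_nat_one_div_lt (show (0 : ℝ) < u from hu0)
  refine mem_iUnion₂.2 ⟨A, hAt, mem_iUnion.2 ⟨m, hxE, ?_, ?_⟩⟩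
  · rw [mem_ball, dist_eq_norm] at hxA
    exact hxA.le
  · intro r hr hrm
    have h := hu ⟨hr, hrm.trans hm⟩
    have hb : volume (ball x r) ≠ 0 := (measure_ball_pos _ _ hr).ne'
    exact (ENNReal.div_le_iff hb measure_ball_lt_top.ne).1 (le_of_lt h)
end

section
/- Let Ω ⊆ ℝⁿ be Lebesgue measurable, let f : Ω → ℝⁿ be a Lebesgue measurable map, and let G ⊆ Ω with |Ω \ G| = 0 be such that f satisfies the Lusin (N) condition on G. Assume moreover that for every measurable E ⊆ Ω with |E| > 0 the image f(E) has positive Lebesgue outer measure. Let Q ⊆ Ω and suppose the set M := {y ∈ Ω \ Q : there exists x ∈ Q ∩ G with f(x) = f(y)} is Lebesgue measurable with |M| > 0. Then there exist disjoint measurable sets A ⊆ M and B ⊆ Q ∩ G with |A| > 0, |B| > 0 and f(A) = f(B). -/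
open MeasureTheory Filter Metric Set
open scoped ENNReal Topology

lemma exists_subset_compact_image {α β : Type*} [t : TopologicalSpace α] [hpt : PolishSpace α]
    [m : MeasurableSpace α] [b : BorelSpace α] [TopologicalSpace β] [SecondCountableTopology β]
    [MeasurableSpace β] [OpensMeasurableSpace β] (μ : Measure α) [SigmaFinite μ]
    {g : α → β} (hg : Measurable g) {s : Set α} (hs : MeasurableSet s) (h0 : 0 < μ s) :
    ∃ K ⊆ s, MeasurableSet K ∧ 0 < μ K ∧ IsCompact (g '' K) := by
  obtain ⟨u, hu, hus, hu0, hut⟩ := Measure.exists_subset_measure_lt_top hs h0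
  obtain ⟨t', hle, hc, hp⟩ := hg.exists_continuous
  have hb : @BorelSpace α t' m := by
    refine @BorelSpace.mk α t' m ?_
    exact (@BorelSpace.measurable_eq α t m b).trans (borel_eq_borel_of_le hp hpt hle).symm
  clear b hle
  let := t'
  obtain ⟨K, hK, hKc, hK0⟩ := hu.exists_lt_isCompact_of_ne_top hut.ne hu0
  exact ⟨K, hK.trans hus, hKc.measurableSet, hK0, hKc.image hc⟩

/-- Let `Ω ⊆ ℝⁿ` be Lebesgue measurable, `f : Ω → ℝⁿ` Lebesgue measurable and `G ⊆ Ω` of full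
measure in `Ω` such that `f` satisfies the Lusin (N) condition on `G`. Assume that images of
positive-measure measurable subsets of `Ω` have positive outer measure. If `Q ⊆ Ω` and
`M = {y ∈ Ω \ Q : ∃ x ∈ Q ∩ G, f x = f y}` is Lebesgue measurable with `|M| > 0`, then there
are disjoint measurable sets `A ⊆ M` and `B ⊆ Q ∩ G` of positive measure with `f(A) = f(B)`. -/
theorem exists_two_sets_with_equal_images
    (n : ℕ) (Ω : Set (EuclideanSpace ℝ (Fin n))) (hΩ : NullMeasurableSet Ω volume)
    (f : EuclideanSpace ℝ (Fin n) → EuclideanSpace ℝ (Fin n))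
    (hf : AEMeasurable f (volume.restrict Ω))
    (G : Set (EuclideanSpace ℝ (Fin n))) (hGΩ : G ⊆ Ω) (hGfull : volume (Ω \ G) = 0)
    (hLusin : ∀ E : Set (EuclideanSpace ℝ (Fin n)), E ⊆ G → volume E = 0 →
      volume (f '' E) = 0)
    (hpos : ∀ E : Set (EuclideanSpace ℝ (Fin n)), E ⊆ Ω → NullMeasurableSet E volume →
      0 < volume E → 0 < volume (f '' E))
    (Q : Set (EuclideanSpace ℝ (Fin n))) (hQΩ : Q ⊆ Ω)
    (M : Set (EuclideanSpace ℝ (Fin n)))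
    (hM : M = {y ∈ Ω \ Q | ∃ x ∈ Q ∩ G, f x = f y})
    (hMmeas : NullMeasurableSet M volume) (hMpos : 0 < volume M) :
    ∃ A B : Set (EuclideanSpace ℝ (Fin n)),
      A ⊆ M ∧ B ⊆ Q ∩ G ∧
      NullMeasurableSet A volume ∧ NullMeasurableSet B volume ∧
      0 < volume A ∧ 0 < volume B ∧ Disjoint A B ∧ f '' A = f '' B := by
  subst hM
  set M : Set (EuclideanSpace ℝ (Fin n)) := {y ∈ Ω \ Q | ∃ x ∈ Q ∩ G, f x = f y} with hMdef
  have hMΩ : M ⊆ Ω := fun y hy => hy.1.1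
  have hGm : NullMeasurableSet G volume := by
    have h : G = Ω \ (Ω \ G) := by
      rw [sdiff_sdiff_right_self, inter_eq_self_of_subset_right hGΩ]
    rw [h]
    exact hΩ.diff (NullMeasurableSet.of_null hGfull)
  obtain ⟨g, hg, hfg⟩ := hf
  have hfgM : ∀ᵐ x ∂(volume.restrict M), f x = g x := ae_mono (Measure.restrict_mono hMΩ le_rfl) hfg
  have hnull : volume (M ∩ {x | ¬ f x = g x}) = 0 := by
    have h := hfgM
    rw [ae_restrict_iff'₀ hMmeas, ae_iff] at h
    convert h using 2
    ext x
    simp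
  have hM1 : NullMeasurableSet (M \ (M ∩ {x | ¬ f x = g x})) volume :=
    hMmeas.diff (NullMeasurableSet.of_null hnull)
  obtain ⟨T, hTs, hT, hTe⟩ := hM1.exists_measurable_subset_ae_eq
  have hT0 : 0 < volume T := by
    rw [measure_congr hTe, measure_sdiff_null hnull]
    exact hMpos
  obtain ⟨K, hKT, hK, hK0, hKc⟩ := exists_subset_compact_image volume hg hT hT0
  have hKM : K ⊆ M := fun x hx => (hTs (hKT hx)).1
  have hKg : f '' K = g '' K := by
    apply image_congr
    intro x hx
    by_contra h
    exact (hTs (hKT hx)).2 ⟨hKM hx, h⟩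
  have hYm : MeasurableSet (f '' K) := hKg ▸ hKc.measurableSet
  have hPm : NullMeasurableSet (Ω ∩ f ⁻¹' (f '' K)) volume := by
    have h1 : NullMeasurableSet (Ω ∩ g ⁻¹' (f '' K)) volume :=
      hΩ.inter (hg hYm).nullMeasurableSet
    refine h1.congr ?_
    have h := hfg
    rw [Filter.EventuallyEq, ae_restrict_iff'₀ hΩ] at h
    filter_upwards [h] with x hx
    apply propext
    constructor
    · rintro ⟨h1, h2⟩
      exact ⟨h1, by rw [mem_preimage, hx h1]; exact h2⟩
    · rintro ⟨h1, h2⟩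
      exact ⟨h1, by rw [mem_preimage, ← hx h1]; exact h2⟩
  have hBsub : ((Ω ∩ f ⁻¹' (f '' K)) \ M) ∩ G ⊆ Q ∩ G := by
    rintro x ⟨⟨⟨hxΩ, k, hk, hkx⟩, hxM⟩, hxG⟩
    refine ⟨?_, hxG⟩
    by_contra hxQ
    obtain ⟨z, hz, hzk⟩ := (hKM hk).2
    exact hxM ⟨⟨hxΩ, hxQ⟩, z, hz, hzk.trans hkx⟩
  have him : f '' K = f '' (((Ω ∩ f ⁻¹' (f '' K)) \ M) ∩ G) := by
    apply Subset.antisymm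
    · rintro _ ⟨k, hk, rfl⟩
      obtain ⟨z, hz, hzk⟩ := (hKM hk).2
      exact ⟨z, ⟨⟨⟨hQΩ hz.1, k, hk, hzk.symm⟩, fun h => h.1.2 hz.1⟩, hz.2⟩, hzk⟩
    · rintro _ ⟨x, hx, rfl⟩
      exact hx.1.1.2
  have hY0 := hpos K (hKM.trans hMΩ) hK.nullMeasurableSet hK0
  refine ⟨K, _, hKM, hBsub, hK.nullMeasurableSet, (hPm.diff hMmeas).inter hGm, hK0, ?_, ?_, him⟩
  · rw [pos_iff_ne_zero]
    intro h
    rw [him, hLusin _ inter_subset_right h] at hY0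
    exact lt_irrefl _ hY0
  · rw [Set.disjoint_left]
    intro x hx hxB
    exact hxB.1.2 (hKM hx)
end

section
/- Let u : [0,1] → ℝⁿ be absolutely continuous, let A ⊆ [0,1] be a nonempty set, and let δ, η ≥ 0 be such that |u(s)| ≤ δ for every s ∈ A and ∫_{[0,1] \ A} |u'(t)| dt ≤ η. Then |u(t)| ≤ δ + η for every t ∈ [0,1]. -/
open MeasureTheory Filter Metric Set
open scoped ENNReal Topology

/-- Let `u : [0,1] → ℝⁿ` be absolutely continuous (with derivative `u' ∈ L¹` satisfying the
fundamental theorem of calculus on `[0,1]`), let `A ⊆ [0,1]` be nonempty (measurable), and let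
`δ, η ≥ 0` be such that `|u(s)| ≤ δ` for every `s ∈ A` and `∫_{[0,1] \ A} |u'| ≤ η`.
Then `|u(t)| ≤ δ + η` for every `t ∈ [0,1]`. -/
theorem norm_le_of_small_on_set_and_small_derivative_off_set
    (n : ℕ) (u u' : ℝ → EuclideanSpace ℝ (Fin n))
    (hu' : IntegrableOn u' (Icc 0 1) volume)
    (hftc : ∀ a b : ℝ, a ∈ Icc (0 : ℝ) 1 → b ∈ Icc (0 : ℝ) 1 → a ≤ b →
      u b - u a = ∫ t in a..b, u' t)
    (A : Set ℝ) (hAsub : A ⊆ Icc 0 1) (hAne : A.Nonempty) (hAmeas : MeasurableSet A)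
    (δ η : ℝ) (hδ : 0 ≤ δ) (hη : 0 ≤ η)
    (hbound : ∀ s ∈ A, ‖u s‖ ≤ δ)
    (hder : ∫ t in Icc 0 1 \ A, ‖u' t‖ ≤ η) :
    ∀ t ∈ Icc (0 : ℝ) 1, ‖u t‖ ≤ δ + η := by
  have hcont : ContinuousOn u (Icc 0 1) := by
    have h1 : ContinuousOn (fun x => ∫ t in (0 : ℝ)..x, u' t) (Icc 0 1) := by
      have := intervalIntegral.continuousOn_primitive_interval (μ := volume) (f := u')
        (a := 0) (b := 1) (by rwa [uIcc_of_le zero_le_one])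
      rwa [uIcc_of_le zero_le_one] at this
    have h2 : ContinuousOn (fun x => u 0 + ∫ t in (0 : ℝ)..x, u' t) (Icc 0 1) :=
      continuousOn_const.add h1
    refine h2.congr fun x hx => ?_
    have := hftc 0 x (by simp) hx hx.1
    simp only [← this]
    abel
  have hclsub : closure A ⊆ Icc 0 1 := closure_minimal hAsub isClosed_Icc
  have hcl : ∀ s ∈ closure A, ‖u s‖ ≤ δ := by
    intro s hs
    have hc : ContinuousWithinAt u A s := (hcont s (hclsub hs)).mono hAsub
    have := mem_closure_iff_nhdsWithin_neBot.1 hs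
    exact le_of_tendsto hc.norm (eventually_nhdsWithin_of_forall hbound)
  have key : ∀ a b : ℝ, a ∈ Icc (0 : ℝ) 1 → b ∈ Icc (0 : ℝ) 1 → a ≤ b →
      (∀ x ∈ Ioo a b, x ∉ A) → ‖u b - u a‖ ≤ η := by
    intro a b ha hb hab hA
    rw [hftc a b ha hb hab, intervalIntegral.integral_of_le hab, integral_Ioc_eq_integral_Ioo]
    refine (norm_integral_le_integral_norm _).trans (le_trans ?_ hder)
    refine setIntegral_mono_set (hu'.mono_set sdiff_subset).norm
      (Eventually.of_forall fun x => norm_nonneg _) (HasSubset.Subset.eventuallyLE ?_)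
    intro x hx
    exact ⟨⟨ha.1.trans hx.1.le, hx.2.le.trans hb.2⟩, hA x hx⟩
  intro t ht
  obtain ⟨b, hb, hbd⟩ := (isCompact_Icc.of_isClosed_subset isClosed_closure
    hclsub).exists_infDist_eq_dist hAne.closure t
  have hmin : ∀ x ∈ A, |t - b| ≤ |t - x| := by
    intro x hx
    rw [← Real.dist_eq, ← Real.dist_eq, ← hbd]
    exact infDist_le_dist_of_mem (subset_closure hx)
  have hd : ‖u t - u b‖ ≤ η := by
    rcases le_total b t with h | h
    · refine key b t (hclsub hb) ht h fun x hx hxA => ?_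
      have := hmin x hxA
      rw [abs_of_nonneg (by linarith), abs_of_nonneg (by linarith [hx.2])] at this
      linarith [hx.1]
    · rw [norm_sub_rev]
      refine key t b ht (hclsub hb) h fun x hx hxA => ?_
      have := hmin x hxA
      rw [abs_of_nonpos (by linarith), abs_of_nonpos (by linarith [hx.1])] at this
      linarith [hx.2]
  have h3 : ‖u t‖ ≤ ‖u b‖ + ‖u t - u b‖ := by
    simpa using norm_add_le (u b) (u t - u b)
  linarith [hcl b hb]
end

section
/- Let n ≥ 2, let T be an n×n real matrix with det T > 0, and let 0 < r < R be such that T maps the closed ball B̄(0,r) into the open ball B(0,R). Then there exists a bi-Lipschitz homeomorphism H : ℝⁿ → ℝⁿ such that H(x) = Tx for every x with |x| ≤ r and H(x) = x for every x with |x| ≥ R. -/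
open MeasureTheory Filter Metric Set
open scoped ENNReal Topology NNReal

section helpers

lemma pert_lip {E : Type*} [NormedAddCommGroup E] [NormedSpace ℝ E] (C : E →L[ℝ] E)
    (p R : ℝ) (hp : p < R) (h : ‖C‖ * (1 + R / (R - p)) ≤ 1 / 2) (χ : E → ℝ)
    (hχ : χ = fun x => max 0 (min 1 ((R - ‖x‖) / (R - p)))) (x y : E) :
    ‖χ x • C x - χ y • C y‖ ≤ 1 / 2 * ‖x - y‖ := by
  have hd : 0 < R - p := sub_pos.2 hp
  have h0 : ∀ x, 0 ≤ χ x := fun x => by simp [hχ]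
  have h1 : ∀ x, χ x ≤ 1 := fun x => by simp [hχ]
  have hz : ∀ x, R ≤ ‖x‖ → χ x = 0 := fun x hx => by
    rw [hχ]; apply max_eq_left
    exact (min_le_right _ _).trans (div_nonpos_of_nonpos_of_nonneg (by linarith) hd.le)
  have hl : ∀ x y, |χ x - χ y| ≤ ‖x - y‖ / (R - p) := fun x y => by
    rw [hχ]
    refine (abs_max_sub_max_le_max _ _ _ _).trans ?_
    refine max_le (by simp; positivity) ?_
    refine (abs_min_sub_min_le_max _ _ _ _).trans ?_
    refine max_le (by simp; positivity) ?_
    rw [← sub_div, abs_div, abs_of_pos hd]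
    gcongr
    rw [show R - ‖x‖ - (R - ‖y‖) = -(‖x‖ - ‖y‖) by ring, abs_neg]
    exact abs_norm_sub_norm_le x y
  have key : ∀ x y : E, ‖y‖ ≤ R → ‖χ x • C x - χ y • C y‖ ≤ 1 / 2 * ‖x - y‖ := fun x y hy => by
    have : χ x • C x - χ y • C y = χ x • C (x - y) + (χ x - χ y) • C y := by
      rw [map_sub]; module
    rw [this]
    calc _ ≤ ‖χ x • C (x - y)‖ + ‖(χ x - χ y) • C y‖ := norm_add_le _ _
      _ = |χ x| * ‖C (x - y)‖ + |χ x - χ y| * ‖C y‖ := by simp [norm_smul]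
      _ ≤ 1 * (‖C‖ * ‖x - y‖) + (‖x - y‖ / (R - p)) * (‖C‖ * R) := by
        gcongr
        · rw [abs_of_nonneg (h0 x)]; exact h1 x
        · exact C.le_opNorm _
        · exact hl x y
        · exact (C.le_opNorm _).trans (by gcongr)
      _ = (‖C‖ * (1 + R / (R - p))) * ‖x - y‖ := by ring
      _ ≤ _ := by gcongr
  rcases le_total ‖y‖ R with hy | hy
  · exact key x y hy
  rcases le_total ‖x‖ R with hx | hx
  · rw [norm_sub_rev, norm_sub_rev x]; exact key y x hx
  · rw [hz x hx, hz y hy]; simp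

lemma pert {E : Type*} [NormedAddCommGroup E] [NormedSpace ℝ E] [CompleteSpace E] [Nontrivial E]
    (C : E →L[ℝ] E)
    (p R : ℝ) (hp : p < R) (h : ‖C‖ * (1 + R / (R - p)) ≤ 1 / 2) :
    ∃ H : E ≃ E, (∃ K : ℝ≥0, LipschitzWith K H ∧ LipschitzWith K H.symm) ∧
      (∀ x, ‖x‖ ≤ p → H x = x + C x) ∧ (∀ x, R ≤ ‖x‖ → H x = x) := by
  have hd : 0 < R - p := sub_pos.2 hp
  obtain ⟨χ, hχ⟩ : ∃ χ : E → ℝ, χ = fun x => max 0 (min 1 ((R - ‖x‖) / (R - p))) := ⟨_, rfl⟩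
  have hg := pert_lip C p R hp h χ hχ
  have hA : ApproximatesLinearOn (fun x => x + χ x • C x)
      ((ContinuousLinearEquiv.refl ℝ E : E ≃L[ℝ] E) : E →L[ℝ] E) univ (1/2 : ℝ≥0) := by
    intro x _ y _
    have e : x + χ x • C x - (y + χ y • C y) - (x - y) = χ x • C x - χ y • C y := by abel
    simpa [e] using hg x y
  have hc : (1/2 : ℝ≥0) < ‖((ContinuousLinearEquiv.refl ℝ E).symm : E →L[ℝ] E)‖₊⁻¹ := by
    have : ‖((ContinuousLinearEquiv.refl ℝ E).symm : E →L[ℝ] E)‖₊ = 1 := by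
      ext; exact ContinuousLinearMap.norm_id
    rw [this, inv_one]
    exact NNReal.half_lt_self one_ne_zero
  have hlow : ∀ x y, ‖x - y‖ ≤ 2 * ‖(x + χ x • C x) - (y + χ y • C y)‖ := fun x y => by
    have h1 := hg x y
    have : x - y = ((x + χ x • C x) - (y + χ y • C y)) - (χ x • C x - χ y • C y) := by abel
    have h2 := norm_sub_le ((x + χ x • C x) - (y + χ y • C y)) (χ x • C x - χ y • C y)
    rw [← this] at h2
    linarith
  have hup : ∀ x y, ‖(x + χ x • C x) - (y + χ y • C y)‖ ≤ 2 * ‖x - y‖ := fun x y => by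
    have h1 := hg x y
    have : (x - y) + (χ x • C x - χ y • C y) = ((x + χ x • C x) - (y + χ y • C y)) := by abel
    have h2 := norm_add_le (x - y) (χ x • C x - χ y • C y)
    rw [this] at h2
    have := norm_nonneg (x - y)
    linarith
  have hinj : Function.Injective (fun x => x + χ x • C x) := fun x y hxy => by
    have := hlow x y
    simp only at hxy
    rw [hxy, sub_self, norm_zero, mul_zero] at this
    exact sub_eq_zero.1 (norm_le_zero_iff.1 this)
  let H := Equiv.ofBijective _ ⟨hinj, hA.surjective (Or.inr hc)⟩
  have hH : ∀ x, H x = x + χ x • C x := fun x => rfl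
  refine ⟨H, ⟨2, ?_, ?_⟩, ?_, ?_⟩
  · apply LipschitzWith.of_dist_le_mul
    intro x y
    rw [dist_eq_norm, dist_eq_norm]
    exact hup x y
  · apply LipschitzWith.of_dist_le_mul
    intro x y
    have := hlow (H.symm x) (H.symm y)
    rw [← hH, ← hH, H.apply_symm_apply, H.apply_symm_apply] at this
    simpa [dist_eq_norm] using this
  · intro x hx
    have : χ x = 1 := by
      rw [hχ]
      have : 1 ≤ (R - ‖x‖) / (R - p) := by rw [le_div_iff₀ hd]; linarith
      simp [min_eq_left this]
    rw [hH, this, one_smul]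
  · intro x hx
    have : χ x = 0 := by
      rw [hχ]; apply max_eq_left
      exact (min_le_right _ _).trans (div_nonpos_of_nonpos_of_nonneg (by linarith) hd.le)
    rw [hH, this, zero_smul, add_zero]

def PthM {n : ℕ} (A : Matrix (Fin n) (Fin n) ℝ) : Prop :=
  ∃ γ : ℝ → Matrix (Fin n) (Fin n) ℝ, Continuous γ ∧ γ 0 = 1 ∧ γ 1 = A ∧
    ∀ t ∈ Icc (0:ℝ) 1, 0 < (γ t).det

lemma PthM.mul {n : ℕ} {A B : Matrix (Fin n) (Fin n) ℝ} (hA : PthM A) (hB : PthM B) :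
    PthM (A * B) := by
  obtain ⟨f, hf, f0, f1, fp⟩ := hA
  obtain ⟨g, hg, g0, g1, gp⟩ := hB
  refine ⟨fun t => f t * g t, hf.matrix_mul hg, by simp [f0, g0], by simp [f1, g1], ?_⟩
  intro t ht
  rw [Matrix.det_mul]
  exact mul_pos (fp t ht) (gp t ht)

lemma PthM.transvection {n : ℕ} {i j : Fin n} (hij : i ≠ j) (c : ℝ) :
    PthM (Matrix.transvection i j c) := by
  refine ⟨fun t => Matrix.transvection i j (t * c), ?_, by simp, by simp, ?_⟩
  · unfold Matrix.transvection
    refine continuous_const.add ?_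
    refine continuous_matrix fun a b => ?_
    simp only [Matrix.single_apply]
    split_ifs <;> fun_prop
  · intro t _
    rw [Matrix.det_transvection_of_ne _ _ hij]; exact one_pos

lemma weyl {n : ℕ} {i j : Fin n} (hij : i ≠ j) (a b : ℝ) (hab : a * b = 1) :
    Matrix.transvection i j a * Matrix.transvection j i (-b) * Matrix.transvection i j a =
      1 + Matrix.single i j a - Matrix.single j i b - Matrix.single i i 1 - Matrix.single j j 1 := by
  have hba : b * a = 1 := by rw [mul_comm]; exact hab
  have e1 : Matrix.single i i (-1 : ℝ) = - Matrix.single i i 1 := by simp [Matrix.single_neg]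
  have e2 : Matrix.single j j (-1 : ℝ) = - Matrix.single j j 1 := by simp [Matrix.single_neg]
  have e3 : Matrix.single i j (-a : ℝ) = - Matrix.single i j a := by simp [Matrix.single_neg]
  have e4 : Matrix.single j i (-b : ℝ) = - Matrix.single j i b := by simp [Matrix.single_neg]
  simp [Matrix.transvection, mul_add, add_mul, Matrix.single_mul_single_of_ne, hij.symm, hab, hba, e4]
  abel

lemma diag_dec {n : ℕ} {i j : Fin n} (hij : i ≠ j) (a : ℝ) (ha : a ≠ 0) :
    Matrix.diagonal (fun k ↦ if k = i then a else if k = j then a⁻¹ else 1) =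
    (Matrix.transvection i j a * Matrix.transvection j i (-a⁻¹) * Matrix.transvection i j a) *
    (Matrix.transvection i j (-1) * Matrix.transvection j i (-(-1)) * Matrix.transvection i j (-1)) := by
  rw [weyl hij _ _ (mul_inv_cancel₀ ha), weyl hij (-1) (-1) (by norm_num)]
  have : Matrix.diagonal (fun k ↦ if k = i then a else if k = j then a⁻¹ else 1) =
    1 + Matrix.single i i a - Matrix.single i i 1 + Matrix.single j j a⁻¹ - Matrix.single j j 1 := by
    ext k l
    simp only [Matrix.diagonal_apply, Matrix.add_apply, Matrix.sub_apply, Matrix.single_apply, Matrix.one_apply]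
    grind
  rw [this]
  have e1 : Matrix.single i j (-1 : ℝ) = - Matrix.single i j 1 := by simp [Matrix.single_neg]
  have e2 : Matrix.single j i (-1 : ℝ) = - Matrix.single j i 1 := by simp [Matrix.single_neg]
  simp [e1, e2, mul_add, add_mul, mul_sub, sub_mul, Matrix.single_mul_single_of_ne, hij, hij.symm]
  abel

lemma PthM.of_det_one {n : ℕ} (hn : 2 ≤ n) (A : Matrix (Fin n) (Fin n) ℝ) (hA : A.det = 1) :
    PthM A := by
  have : Nontrivial (Fin n) := Fin.nontrivial_iff_two_le.2 hn
  refine Matrix.SpecialLinearGroup.diagonal_transvection_induction' (fun M => PthM M.1) ⟨A, hA⟩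
    ?_ ?_ ?_
  · intro i j hij c hc
    simp only [Matrix.SpecialLinearGroup.diag2n_coe]
    rw [diag_dec hij c hc]
    have := fun a => PthM.transvection hij a
    have := fun a => PthM.transvection hij.symm a
    apply_rules [PthM.mul]
  · intro i j hij a
    exact PthM.transvection hij a
  · intro A B hA hB
    exact hA.mul hB

lemma PthM.of_det_pos {n : ℕ} (hn : 2 ≤ n) (A : Matrix (Fin n) (Fin n) ℝ) (hA : 0 < A.det) :
    PthM A := by
  obtain ⟨c, hc, hcn⟩ : ∃ c : ℝ, 0 < c ∧ c ^ n = A.det :=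
    ⟨A.det ^ (1 / n : ℝ), by positivity, by
      rw [one_div]; exact Real.rpow_inv_natCast_pow hA.le (by omega)⟩
  obtain ⟨f, hf, f0, f1, fp⟩ := PthM.of_det_one hn (c⁻¹ • A) (by
    rw [Matrix.det_smul, Fintype.card_fin, ← hcn, ← mul_pow, inv_mul_cancel₀ hc.ne', one_pow])
  refine ⟨fun t => (1 - t + t * c) • f t, by fun_prop, by simp [f0], by simp [f1, hc.ne'], ?_⟩
  intro t ht
  have : 0 < 1 - t + t * c := by
    rcases ht.1.eq_or_lt with h | h
    · rw [← h]; simp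
    · have := ht.2; nlinarith [mul_pos h hc]
  rw [Matrix.det_smul]
  exact mul_pos (pow_pos this _) (fp t ht)


open scoped Matrix.Norms.L2Operator

lemma omega_conn {n : ℕ} (hn : 2 ≤ n) (q : ℝ) (hq : 1 < q) :
    IsPreconnected {A : Matrix (Fin n) (Fin n) ℝ | 0 < A.det ∧ ‖A‖ < q} := by
  have : Nontrivial (Fin n) := Fin.nontrivial_iff_two_le.2 hn
  have hone : ‖(1 : Matrix (Fin n) (Fin n) ℝ)‖ = 1 := norm_one
  apply isPreconnected_of_forall (1 : Matrix (Fin n) (Fin n) ℝ)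
  rintro A ⟨hA, hAq⟩
  obtain ⟨f, hf, f0, f1, fp⟩ := PthM.of_det_pos hn A hA
  obtain ⟨M, hM⟩ := (isCompact_Icc (a := (0:ℝ)) (b := 1)).exists_bound_of_continuousOn
    hf.continuousOn
  have hM1 : 1 ≤ M := by
    have := hM 0 (by simp)
    rwa [f0, hone] at this
  have hM0 : 0 < M := by linarith
  have hs0 : 0 < M⁻¹ := by positivity
  have hs1 : M⁻¹ ≤ 1 := inv_le_one_of_one_le₀ hM1
  have hsm : M⁻¹ * M = 1 := inv_mul_cancel₀ hM0.ne'
  have hpos : ∀ (u : ℝ) (B : Matrix (Fin n) (Fin n) ℝ), 0 < u → 0 < B.det → 0 < (u • B).det :=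
    fun u B hu hB => by rw [Matrix.det_smul]; positivity
  have hseg : ∀ B : Matrix (Fin n) (Fin n) ℝ,
      IsPreconnected ((fun u : ℝ => u • B) '' Icc M⁻¹ 1) := fun B =>
    isPreconnected_Icc.image _ (by fun_prop)
  have hmid : IsPreconnected ((fun t : ℝ => M⁻¹ • f t) '' Icc 0 1) :=
    isPreconnected_Icc.image _ (by fun_prop)
  have hsub : ∀ B : Matrix (Fin n) (Fin n) ℝ, 0 < B.det → ‖B‖ < q →
      (fun u : ℝ => u • B) '' Icc M⁻¹ 1 ⊆
        {A : Matrix (Fin n) (Fin n) ℝ | 0 < A.det ∧ ‖A‖ < q} := by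
    rintro B hB hBq _ ⟨u, hu, rfl⟩
    have hu0 : 0 < u := hs0.trans_le hu.1
    refine ⟨hpos u B hu0 hB, ?_⟩
    rw [norm_smul, Real.norm_eq_abs, abs_of_pos hu0]
    exact (mul_le_of_le_one_left (norm_nonneg _) hu.2).trans_lt hBq
  refine ⟨((fun u : ℝ => u • (1 : Matrix (Fin n) (Fin n) ℝ)) '' Icc M⁻¹ 1 ∪
    (fun t : ℝ => M⁻¹ • f t) '' Icc 0 1) ∪ (fun u : ℝ => u • A) '' Icc M⁻¹ 1, ?_, ?_, ?_, ?_⟩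
  · refine union_subset (union_subset (hsub 1 (by simp) (by rwa [hone])) ?_) (hsub A hA hAq)
    rintro _ ⟨t, ht, rfl⟩
    refine ⟨hpos _ _ hs0 (fp t ht), ?_⟩
    rw [norm_smul, Real.norm_eq_abs, abs_of_pos hs0]
    have := mul_le_mul_of_nonneg_left (hM t ht) hs0.le
    linarith
  · exact Or.inl (Or.inl ⟨1, ⟨hs1, le_rfl⟩, one_smul _ _⟩)
  · exact Or.inr ⟨1, ⟨hs1, le_rfl⟩, one_smul _ _⟩
  · refine IsPreconnected.union (M⁻¹ • A) ?_ ⟨M⁻¹, ⟨le_rfl, hs1⟩, rfl⟩ ?_ (hseg A)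
    · exact Or.inr ⟨1, by simp, by simp [f1]⟩
    · exact IsPreconnected.union (M⁻¹ • (1 : Matrix (Fin n) (Fin n) ℝ))
        ⟨M⁻¹, ⟨le_rfl, hs1⟩, rfl⟩ ⟨0, by simp, by simp [f0]⟩ (hseg 1) hmid

def GoodM {n : ℕ} (r R : ℝ) (A : Matrix (Fin n) (Fin n) ℝ) : Prop :=
  ∃ H : EuclideanSpace ℝ (Fin n) ≃ EuclideanSpace ℝ (Fin n),
      (∃ K : ℝ≥0, LipschitzWith K H ∧ LipschitzWith K H.symm) ∧
      (∀ x : EuclideanSpace ℝ (Fin n), ‖x‖ ≤ r →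
        H x = Matrix.toEuclideanCLM (n := Fin n) (𝕜 := ℝ) A x) ∧
      (∀ x : EuclideanSpace ℝ (Fin n), R ≤ ‖x‖ → H x = x)

lemma GoodM.step {n : ℕ} (hn : 2 ≤ n) {r R p : ℝ} (hp : p < R)
    {A B : Matrix (Fin n) (Fin n) ℝ} (hdet : 0 < A.det) (hA : ‖A‖ * r ≤ p)
    (hAB : ‖B * A⁻¹ - 1‖ * (1 + R / (R - p)) ≤ 1 / 2) (h : GoodM r R A) : GoodM r R B := by
  have : Nontrivial (Fin n) := Fin.nontrivial_iff_two_le.2 hn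
  obtain ⟨H, ⟨K, hK, hK'⟩, h1, h2⟩ := h
  obtain ⟨G, ⟨L, hL, hL'⟩, g1, g2⟩ := pert
    (Matrix.toEuclideanCLM (n := Fin n) (𝕜 := ℝ) (B * A⁻¹ - 1)) p R hp
    (by rwa [Matrix.l2_opNorm_toEuclideanCLM])
  refine ⟨H.trans G, ⟨L * K + K * L, ?_, ?_⟩, ?_, ?_⟩
  · exact (hL.comp hK).weaken le_self_add
  · exact (hK'.comp hL').weaken le_add_self
  · intro x hx
    have hb : ‖Matrix.toEuclideanCLM (n := Fin n) (𝕜 := ℝ) A x‖ ≤ p := by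
      refine ((Matrix.toEuclideanCLM (n := Fin n) (𝕜 := ℝ) A).le_opNorm x).trans ?_
      rw [Matrix.l2_opNorm_toEuclideanCLM]
      exact (mul_le_mul_of_nonneg_left hx (norm_nonneg _)).trans hA
    rw [Equiv.trans_apply, h1 x hx, g1 _ hb, map_sub, map_one]
    have : Matrix.toEuclideanCLM (n := Fin n) (𝕜 := ℝ) (B * A⁻¹)
        (Matrix.toEuclideanCLM (n := Fin n) (𝕜 := ℝ) A x) =
        Matrix.toEuclideanCLM (n := Fin n) (𝕜 := ℝ) B x := by
      have e : B * A⁻¹ * A = B := by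
        rw [mul_assoc, Matrix.nonsing_inv_mul _ (isUnit_iff_ne_zero.2 hdet.ne'), mul_one]
      have e' := congrArg (fun M => Matrix.toEuclideanCLM (n := Fin n) (𝕜 := ℝ) M x) e
      simp only [map_mul] at e' ⊢
      exact e'
    rw [ContinuousLinearMap.sub_apply, this]
    simp
  · intro x hx
    rw [Equiv.trans_apply, h2 x hx, g2 x hx]

lemma GoodM.main {n : ℕ} (hn : 2 ≤ n) {r R : ℝ} (hr : 0 < r) (hrR : r < R)
    {T : Matrix (Fin n) (Fin n) ℝ} (hdet : 0 < T.det) (hT : ‖T‖ < R / r) : GoodM r R T := by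
  have : Nontrivial (Fin n) := Fin.nontrivial_iff_two_le.2 hn
  have hone : ‖(1 : Matrix (Fin n) (Fin n) ℝ)‖ = 1 := norm_one
  have hq : 1 < R / r := by rwa [one_lt_div hr]
  refine (omega_conn hn (R / r) hq).induction₂' (fun A B => GoodM r R A → GoodM r R B)
    ?_ (fun _ _ _ _ _ _ h1 h2 h => h2 (h1 h)) (x := 1) (y := T) ⟨by simp, by rwa [hone]⟩
    ⟨hdet, hT⟩ ⟨Equiv.refl _, ⟨1, LipschitzWith.id, LipschitzWith.id⟩, by simp, by simp⟩
  rintro A ⟨hA, hAq⟩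
  rw [lt_div_iff₀ hr] at hAq
  obtain ⟨p, hp1, hp2⟩ := exists_between hAq
  have hu : IsUnit A := (Matrix.isUnit_iff_isUnit_det A).2 (isUnit_iff_ne_zero.2 hA.ne')
  have hAA : A * A⁻¹ = 1 := Matrix.mul_nonsing_inv _ (isUnit_iff_ne_zero.2 hA.ne')
  have hinv : ContinuousAt (fun B : Matrix (Fin n) (Fin n) ℝ => B⁻¹) A := by
    simp only [Matrix.nonsing_inv_eq_ringInverse]
    obtain ⟨u, rfl⟩ := hu
    exact NormedRing.inverse_continuousAt u
  have c1 : ContinuousAt (fun B : Matrix (Fin n) (Fin n) ℝ =>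
      ‖B * A⁻¹ - 1‖ * (1 + R / (R - p))) A := by fun_prop
  have c2 : ContinuousAt (fun B : Matrix (Fin n) (Fin n) ℝ =>
      ‖A * B⁻¹ - 1‖ * (1 + R / (R - p))) A := by fun_prop
  have c3 : ContinuousAt (fun B : Matrix (Fin n) (Fin n) ℝ => ‖B‖ * r) A := by fun_prop
  have e1 := c1.eventually_lt (continuousAt_const (y := (1 / 2 : ℝ))) (by simp [hAA])
  have e2 := c2.eventually_lt (continuousAt_const (y := (1 / 2 : ℝ))) (by simp [hAA])
  have e3 := c3.eventually_lt (continuousAt_const (y := p)) hp1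
  filter_upwards [self_mem_nhdsWithin, nhdsWithin_le_nhds e1, nhdsWithin_le_nhds e2,
    nhdsWithin_le_nhds e3] with B hB h1 h2 h3
  exact ⟨GoodM.step hn hp2 hA hp1.le h1.le, GoodM.step hn hp2 hB.1 h3.le h2.le⟩

lemma norm_lt_of_maps {n : ℕ} {r R : ℝ} (hr : 0 < r) (T : Matrix (Fin n) (Fin n) ℝ)
    (hmaps : ∀ x : EuclideanSpace ℝ (Fin n), ‖x‖ ≤ r → ‖Matrix.toEuclideanLin T x‖ < R) :
    ‖T‖ < R / r := by
  set F := Matrix.toEuclideanCLM (n := Fin n) (𝕜 := ℝ) T with hF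
  obtain ⟨x0, hx0, hmax⟩ := (isCompact_closedBall (0 : EuclideanSpace ℝ (Fin n)) r).exists_isMaxOn
    ⟨0, by simp [hr.le]⟩ (f := fun x => ‖F x‖) (by fun_prop)
  have hlt : ‖F x0‖ < R := hmaps x0 (by simpa using hx0)
  rw [← Matrix.l2_opNorm_toEuclideanCLM, ← hF]
  refine lt_of_le_of_lt ?_ ((div_lt_div_iff_of_pos_right hr).2 hlt)
  refine ContinuousLinearMap.opNorm_le_of_unit_norm (by positivity) fun x hx => ?_
  have h1 : r • x ∈ closedBall (0 : EuclideanSpace ℝ (Fin n)) r := by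
    simp [norm_smul, hx, abs_of_pos hr]
  have h2 : ‖F (r • x)‖ ≤ ‖F x0‖ := hmax h1
  rw [map_smul, norm_smul, Real.norm_eq_abs, abs_of_pos hr] at h2
  rw [le_div_iff₀ hr]; linarith

end helpers

/-- Let `n ≥ 2`, let `T` be an `n × n` real matrix with `det T > 0` and let `0 < r < R` be
such that `T` maps the closed ball `B̄(0,r)` into the open ball `B(0,R)`. Then there is a
bi-Lipschitz homeomorphism `H : ℝⁿ → ℝⁿ` with `H x = T x` for `|x| ≤ r` and `H x = x` for
`|x| ≥ R`. -/
theorem exists_bilipschitz_extension_of_matrix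
    (n : ℕ) (hn : 2 ≤ n) (T : Matrix (Fin n) (Fin n) ℝ) (hT : 0 < T.det)
    (r R : ℝ) (hr : 0 < r) (hrR : r < R)
    (hmaps : ∀ x : EuclideanSpace ℝ (Fin n), ‖x‖ ≤ r → ‖Matrix.toEuclideanLin T x‖ < R) :
    ∃ H : EuclideanSpace ℝ (Fin n) ≃ EuclideanSpace ℝ (Fin n),
      (∃ K : ℝ≥0, LipschitzWith K H ∧ LipschitzWith K H.symm) ∧
      (∀ x : EuclideanSpace ℝ (Fin n), ‖x‖ ≤ r → H x = Matrix.toEuclideanLin T x) ∧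
      (∀ x : EuclideanSpace ℝ (Fin n), R ≤ ‖x‖ → H x = x) := by
  exact GoodM.main hn hr hrR hT (norm_lt_of_maps hr T hmaps)
end
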